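/- arXiv:2011.04611 — 12 statements merged into one kernel-verified Lean document; each statement's English description precedes it below -/
import Mathlib

section
/- Let 𝒞, 𝒟 ⊆ M_{m×n}(𝔽_q) be matrix codes that are right equivalent, i.e., 𝒞Q = 𝒟 for some Q ∈ GL_n(𝔽_q), and suppose that dim_{𝔽_q} Cond(𝒞,𝒟) ≥ 2. Then both 𝒞 and 𝒟 have nontrivial right stabilizer algebras: each of Stab_r(𝒞) and Stab_r(𝒟) contains a matrix that is not a scalar multiple λIₙ of the identity. -/
/-- The conductor Cond(𝒞,𝒟) = {M ∈ M_{n×n}(𝔽_q) : 𝒞M ⊆ 𝒟} as an 𝔽_q-linear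
subspace of M_{n×n}(𝔽_q). -/
def matrixConductor {F : Type*} [Field F] {m n : ℕ}
    (C D : Submodule F (Matrix (Fin m) (Fin n) F)) :
    Submodule F (Matrix (Fin n) (Fin n) F) where
  carrier := {M | ∀ X ∈ C, X * M ∈ D}
  add_mem' := by
    intro M N hM hN X hX
    simpa [Matrix.mul_add] using D.add_mem (hM X hX) (hN X hX)
  zero_mem' := by
    intro X hX
    simp
  smul_mem' := by
    intro c M hM X hX
    simpa [Matrix.mul_smul] using D.smul_mem c (hM X hX)

/-- If 𝒞 and 𝒟 are right equivalent and dim Cond(𝒞,𝒟) ≥ 2, then both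
right stabilizer algebras are nontrivial: each contains a matrix which is not a
scalar multiple of the identity. -/
theorem nontrivial_stabilizers_of_large_conductor
    {F : Type*} [Field F] [Fintype F] {m n : ℕ}
    (C D : Submodule F (Matrix (Fin m) (Fin n) F))
    (Q : Matrix (Fin n) (Fin n) F) (hQ : IsUnit Q)
    (hCD : (fun X => X * Q) '' (C : Set (Matrix (Fin m) (Fin n) F))
            = (D : Set (Matrix (Fin m) (Fin n) F)))
    (hdim : 2 ≤ Module.finrank F (matrixConductor C D)) :
    (∃ M : Matrix (Fin n) (Fin n) F, (∀ X ∈ C, X * M ∈ C) ∧ ∀ lam : F, M ≠ lam • (1 : Matrix (Fin n) (Fin n) F)) ∧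
    (∃ M : Matrix (Fin n) (Fin n) F, (∀ X ∈ D, X * M ∈ D) ∧ ∀ lam : F, M ≠ lam • (1 : Matrix (Fin n) (Fin n) F)) := by
  have hdet := (Matrix.isUnit_iff_isUnit_det Q).mp hQ
  obtain ⟨N, hN, hNQ⟩ : ∃ N ∈ matrixConductor C D, N ∉ Submodule.span F {Q} := by
    by_contra! h
    have h₁ := Submodule.finrank_mono (R := F) (show matrixConductor C D ≤ Submodule.span F {Q} from h)
    have h₂ := (finrank_span_le_card (R := F) ({Q} : Set (Matrix (Fin n) (Fin n) F))).trans_eq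
      (Set.toFinset_card _)
    rw [Set.card_singleton] at h₂
    omega
  have hC : ∀ X, X * Q ∈ D → X ∈ C := by
    intro X hX
    obtain ⟨Y, hY, hYX⟩ : X * Q ∈ (fun X => X * Q) '' (C : Set (Matrix (Fin m) (Fin n) F)) := hCD ▸ hX
    have h := congrArg (· * Q⁻¹) hYX
    simp only [Matrix.mul_nonsing_inv_cancel_right _ _ hdet] at h
    exact h ▸ hY
  refine ⟨⟨N * Q⁻¹, fun X hX => hC _ ?_, fun lam h => hNQ ?_⟩,
    ⟨Q⁻¹ * N, fun X hX => ?_, fun lam h => hNQ ?_⟩⟩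
  · rw [Matrix.mul_assoc, Matrix.nonsing_inv_mul_cancel_right _ _ hdet]
    exact hN X hX
  · refine Submodule.mem_span_singleton.mpr ⟨lam, ?_⟩
    rw [← Matrix.nonsing_inv_mul_cancel_right Q N hdet, h, Matrix.smul_mul, Matrix.one_mul]
  · rw [← Matrix.mul_assoc]
    refine hN _ (hC _ ?_)
    rwa [Matrix.nonsing_inv_mul_cancel_right _ _ hdet]
  · refine Submodule.mem_span_singleton.mpr ⟨lam, ?_⟩
    rw [← Matrix.mul_nonsing_inv_cancel_left Q N hdet, h, Matrix.mul_smul, Matrix.mul_one]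
end

section
/- Let 𝒞, 𝒟 ⊆ M_{m×n}(𝔽_q) be matrix codes that are right equivalent (𝒞Q = 𝒟 for some Q ∈ GL_n(𝔽_q)), and suppose that the right stabilizer algebra Stab_r(𝒞) is a local algebra with Jacobson radical ℛ. Then every element of Cond(𝒞,𝒟) that does not belong to ℛ·Cond(𝒞,𝒟) (the 𝔽_q-span of all products RM with R ∈ ℛ and M ∈ Cond(𝒞,𝒟)) is an invertible matrix. -/
/-- Suppose 𝒞 and 𝒟 are right equivalent and Stab_r(𝒞) is a local
algebra (for a, b in it summing to the identity, a or b is invertible) with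
Jacobson radical ℛ (= the set of non-invertible elements of Stab_r(𝒞), since the
algebra is local).  Then every element of Cond(𝒞,𝒟) not belonging to the span of
ℛ·Cond(𝒞,𝒟) is an invertible matrix. -/
theorem local_stabilizer_conductor_units
    {F : Type*} [Field F] [Fintype F] {m n : ℕ}
    (C D : Submodule F (Matrix (Fin m) (Fin n) F))
    (hequiv : ∃ Q : Matrix (Fin n) (Fin n) F, IsUnit Q ∧
      (fun X => X * Q) '' (C : Set (Matrix (Fin m) (Fin n) F))
        = (D : Set (Matrix (Fin m) (Fin n) F)))
    (hlocal : ∀ a b : Matrix (Fin n) (Fin n) F,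
      (∀ X ∈ C, X * a ∈ C) → (∀ X ∈ C, X * b ∈ C) → a + b = 1 → IsUnit a ∨ IsUnit b)
    (R : Set (Matrix (Fin n) (Fin n) F))
    (hR : R = {M | (∀ X ∈ C, X * M ∈ C) ∧ ¬ IsUnit M}) :
    ∀ M : Matrix (Fin n) (Fin n) F, (∀ X ∈ C, X * M ∈ D) →
      M ∉ Submodule.span F {Y : Matrix (Fin n) (Fin n) F |
        ∃ r ∈ R, ∃ N : Matrix (Fin n) (Fin n) F, (∀ X ∈ C, X * N ∈ D) ∧ Y = r * N} →
      IsUnit M := by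
  intro M hM hspan
  by_contra hunit
  obtain ⟨Q, ⟨U, rfl⟩, hQ⟩ := hequiv
  apply hspan
  refine Submodule.subset_span ⟨M * (U⁻¹).val, ?_, U, fun X hX => ?_, by simp [mul_assoc]⟩
  · rw [hR]
    refine ⟨fun X hX => ?_, by simpa using hunit⟩
    obtain ⟨Y, hY, hYM⟩ := hQ.superset (hM X hX)
    rwa [← Matrix.mul_assoc, show X * M = Y * U.val from hYM.symm, Matrix.mul_assoc,
      Units.mul_inv, Matrix.mul_one]
  · exact hQ.subset ⟨X, hX, rfl⟩
end

section
/- Let 𝒞, 𝒟 ⊆ M_{m×n}(𝔽_q) be matrix codes with 𝒞Q = 𝒟 for some Q ∈ GL_n(𝔽_q). Let Iₙ = E₁ + ⋯ + E_ℓ be a decomposition of the identity into pairwise orthogonal minimal idempotents of Stab_r(𝒞) and Iₙ = F₁ + ⋯ + F_{ℓ'} a decomposition of the identity into pairwise orthogonal minimal idempotents of Stab_r(𝒟). For each i, write E_i = A_i·B_iᵀ with A_i, B_i ∈ M_{n×rank(E_i)}(𝔽_q) full-rank and B_iᵀA_i = I, and F_j = U_j·V_jᵀ with U_j, V_j ∈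 M_{n×rank(F_j)}(𝔽_q) full-rank and V_jᵀU_j = I. Then ℓ = ℓ' and there exists a permutation σ of {1,…,ℓ} such that, for every i, the matrix codes 𝒞A_i and 𝒟U_{σ(i)} are right equivalent; in particular rank(E_i) = rank(F_{σ(i)}). -/
open Matrix

/-- The right stabilizer algebra Stab_r(𝒞) = {M : 𝒞M ⊆ 𝒞}, as a set. -/
def rightStab {F : Type*} [Field F] {m n : ℕ}
    (C : Submodule F (Matrix (Fin m) (Fin n) F)) : Set (Matrix (Fin n) (Fin n) F) :=
  {M | ∀ X ∈ C, X * M ∈ C}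

/-- A minimal idempotent of the right stabilizer algebra of 𝒞: a nonzero
idempotent of Stab_r(𝒞) which is not the sum of two nonzero orthogonal
idempotents of Stab_r(𝒞). -/
def IsMinIdemOfStab {F : Type*} [Field F] {m n : ℕ}
    (C : Submodule F (Matrix (Fin m) (Fin n) F)) (E : Matrix (Fin n) (Fin n) F) : Prop :=
  E ∈ rightStab C ∧ E ≠ 0 ∧ E * E = E ∧
    ¬ ∃ E₁ E₂ : Matrix (Fin n) (Fin n) F,
        E₁ ∈ rightStab C ∧ E₂ ∈ rightStab C ∧ E₁ ≠ 0 ∧ E₂ ≠ 0 ∧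
        E₁ * E₁ = E₁ ∧ E₂ * E₂ = E₂ ∧ E₁ * E₂ = 0 ∧ E₂ * E₁ = 0 ∧ E = E₁ + E₂

/-- In a finite monoid every element has an idempotent positive power. -/
theorem exists_pos_isIdempotentElem_pow {M : Type*} [Monoid M] [Finite M] (x : M) :
    ∃ k, 0 < k ∧ IsIdempotentElem (x ^ k) := by
  obtain ⟨a, b, hab, h⟩ : ∃ a b : ℕ, a < b ∧ x ^ a = x ^ b := by
    obtain ⟨a, b, hne, h⟩ := Finite.exists_ne_map_eq_of_infinite (fun k : ℕ => x ^ k)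
    rcases lt_or_gt_of_ne hne with hlt | hlt
    exacts [⟨a, b, hlt, h⟩, ⟨b, a, hlt, h.symm⟩]
  obtain ⟨p, rfl⟩ := Nat.exists_eq_add_of_lt hab
  have period (t : ℕ) : x ^ (a + t * (p + 1)) = x ^ a := by
    induction t with
    | zero => simp
    | succ t ih =>
      rw [show a + (t + 1) * (p + 1) = (a + t * (p + 1)) + (p + 1) by ring, pow_add, ih,
        ← pow_add, ← add_assoc, ← h]
  refine ⟨(a + 1) * (p + 1), by positivity, ?_⟩
  have hsplit : (a + 1) * (p + 1) = a + (a * p + p + 1) := by ring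
  rw [IsIdempotentElem, ← pow_add]
  nth_rewrite 1 [hsplit]
  rw [show a + (a * p + p + 1) + (a + 1) * (p + 1)
    = a + (a + 1) * (p + 1) + (a * p + p + 1) by ring, pow_add, period, ← pow_add, ← hsplit]

/-- A finite ring whose only idempotents are `0` and `1` is local. -/
theorem IsLocalRing.of_finite_of_isIdempotentElem {R : Type*} [Ring R] [Finite R] [Nontrivial R]
    (h : ∀ x : R, IsIdempotentElem x → x = 0 ∨ x = 1) : IsLocalRing R := by
  refine .of_isUnit_or_isUnit_one_sub_self fun x => ?_
  obtain ⟨k, hk, hx⟩ := exists_pos_isIdempotentElem_pow x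
  rcases h _ hx with h0 | h1
  · exact .inr (IsNilpotent.isUnit_one_sub ⟨k, h0⟩)
  · exact .inl (IsUnit.of_pow_eq_one h1 hk.ne')

/-- A nonzero idempotent `e` such that `0` and `e` are the only idempotents below it. -/
structure IsPrimitiveIdempotent {R : Type*} [Ring R] (e : R) : Prop where
  isIdempotentElem : IsIdempotentElem e
  ne_zero : e ≠ 0
  eq_zero_or_eq : ∀ x, IsIdempotentElem x → e * x = x → x * e = x → x = 0 ∨ x = e

theorem IsPrimitiveIdempotent.map {R S : Type*} [Ring R] [Ring S] {e : R}
    (he : IsPrimitiveIdempotent e) (φ : R ≃+* S) : IsPrimitiveIdempotent (φ e) := by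
  refine ⟨he.isIdempotentElem.map φ, (map_ne_zero_iff φ φ.injective).2 he.ne_zero, ?_⟩
  intro x hx hex hxe
  obtain ⟨x, rfl⟩ := φ.surjective x
  rw [IsIdempotentElem, ← map_mul, φ.injective.eq_iff] at hx
  rw [← map_mul, φ.injective.eq_iff] at hex hxe
  rw [map_eq_zero_iff φ φ.injective, φ.injective.eq_iff]
  exact he.eq_zero_or_eq x hx hex hxe

theorem IsPrimitiveIdempotent.isLocalRing_corner {R : Type*} [Ring R] [Finite R] {e : R}
    (he : IsPrimitiveIdempotent e) : IsLocalRing he.isIdempotentElem.Corner := by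
  have : Nontrivial he.isIdempotentElem.Corner :=
    ⟨0, 1, fun h => he.ne_zero (congrArg Subtype.val h).symm⟩
  have : Finite he.isIdempotentElem.Corner := Subtype.finite
  refine .of_finite_of_isIdempotentElem fun x hx => ?_
  obtain ⟨hl, hr⟩ := (Subsemigroup.mem_corner_iff he.isIdempotentElem).1 x.2
  exact (he.eq_zero_or_eq x.1 (congrArg Subtype.val hx) hl hr).imp Subtype.ext Subtype.ext

/-- If a finite sum of elements of the corner of a primitive idempotent `e` equals `e`, one of the
summands is invertible in the corner. -/
theorem IsPrimitiveIdempotent.exists_inverse_of_sum_eq {R ι : Type*} [Ring R] [Finite R]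
    [Fintype ι] {e : R} (he : IsPrimitiveIdempotent e) (x : ι → R) (hl : ∀ i, e * x i = x i)
    (hr : ∀ i, x i * e = x i) (hsum : ∑ i, x i = e) :
    ∃ i u, e * u = u ∧ u * e = u ∧ x i * u = e ∧ u * x i = e := by
  have := he.isLocalRing_corner
  let y (i : ι) : he.isIdempotentElem.Corner :=
    ⟨x i, (Subsemigroup.mem_corner_iff he.isIdempotentElem).2 ⟨hl i, hr i⟩⟩
  have hy : ∑ i, y i = 1 := by
    let coe : he.isIdempotentElem.Corner →+ R :=
      { toFun := fun z => z.1, map_zero' := rfl, map_add' := fun _ _ => rfl }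
    exact Subtype.ext ((map_sum coe y Finset.univ).trans hsum)
  obtain ⟨i, -, v, hv⟩ :=
    IsLocalRing.exists_of_isUnit_sum (s := Finset.univ) (f := y) (hy ▸ isUnit_one)
  obtain ⟨hvl, hvr⟩ := (Subsemigroup.mem_corner_iff he.isIdempotentElem).1 (v⁻¹).1.2
  refine ⟨i, (v⁻¹).1.1, hvl, hvr, ?_, ?_⟩
  · have h := v.mul_inv
    rw [hv] at h
    exact congrArg Subtype.val h
  · have h := v.inv_mul
    rw [hv] at h
    exact congrArg Subtype.val h

/-- Equivalence of idempotents: `e = a * b` and `f = b * a` with `a ∈ e R f` and `b ∈ f R e`. -/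
structure IdempotentIso {R : Type*} [Ring R] (e f a b : R) : Prop where
  left_mul_hom : e * a = a
  hom_mul_right : a * f = a
  right_mul_inv : f * b = b
  inv_mul_left : b * e = b
  hom_mul_inv : a * b = e
  inv_mul_hom : b * a = f

/-- Cancellation: if `e₀ + e₁` and `f₀ + f₁` are equivalent by `a`, `b` and the block `e₀ * a * f₀`
has inverse `y`, then the Schur complement gives an equivalence of `e₁` and `f₁`. -/
theorem IdempotentIso.schurComplement {R : Type*} [Ring R] {e₀ e₁ f₀ f₁ a b y : R}
    (h : IdempotentIso (e₀ + e₁) (f₀ + f₁) a b)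
    (he₁ : IsIdempotentElem e₁) (hf₁ : IsIdempotentElem f₁)
    (he₀₁ : e₀ * e₁ = 0) (he₁₀ : e₁ * e₀ = 0) (hf₁₀ : f₁ * f₀ = 0)
    (hy : IdempotentIso e₀ f₀ (e₀ * a * f₀) y) :
    IdempotentIso e₁ f₁ (e₁ * (a - a * y * a) * f₁) (f₁ * b * e₁) := by
  have hye : y * e₁ = 0 := by rw [← hy.inv_mul_left, mul_assoc, he₀₁, mul_zero]
  have hfy : f₁ * y = 0 := by rw [← hy.right_mul_inv, ← mul_assoc, hf₁₀, zero_mul]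
  have hyaf : y * a * f₀ = f₀ := by
    have := hy.inv_mul_hom
    rwa [← mul_assoc, ← mul_assoc, hy.inv_mul_left] at this
  have heay : e₀ * a * y = e₀ := by
    have := hy.hom_mul_inv
    rwa [mul_assoc, hy.right_mul_inv] at this
  have hafb : a * f₁ * b = e₀ + e₁ - a * f₀ * b := by
    rw [eq_sub_iff_add_eq, ← add_mul, ← mul_add, add_comm f₁, h.hom_mul_right, h.hom_mul_inv]
  have hbea : b * e₁ * a = f₀ + f₁ - b * e₀ * a := by
    rw [eq_sub_iff_add_eq, ← add_mul, ← mul_add, add_comm e₁, h.inv_mul_left, h.inv_mul_hom]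
  refine ⟨?_, ?_, ?_, ?_, ?_, ?_⟩
  · simp only [← mul_assoc, he₁.eq]
  · simp only [mul_assoc, hf₁.eq]
  · simp only [← mul_assoc, hf₁.eq]
  · simp only [mul_assoc, he₁.eq]
  · calc e₁ * (a - a * y * a) * f₁ * (f₁ * b * e₁)
        = e₁ * (a * (f₁ * f₁) * b) * e₁ - e₁ * a * y * (a * (f₁ * f₁) * b) * e₁ := by noncomm_ring
      _ = e₁ * e₀ * e₁ + e₁ * e₁ * e₁ - e₁ * a * f₀ * b * e₁
          - (e₁ * a * (y * e₀) * e₁ + e₁ * a * (y * e₁) * e₁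
            - e₁ * a * (y * a * f₀) * b * e₁) := by rw [hf₁.eq, hafb]; noncomm_ring
      _ = e₁ := by
        rw [hy.inv_mul_left, hyaf, he₁₀, hye, mul_assoc (e₁ * a) y, hye, he₁.eq, he₁.eq]
        noncomm_ring
  · calc f₁ * b * e₁ * (e₁ * (a - a * y * a) * f₁)
        = f₁ * (b * (e₁ * e₁) * a) * f₁ - f₁ * (b * (e₁ * e₁) * a) * y * a * f₁ := by noncomm_ring
      _ = f₁ * f₀ * f₁ + f₁ * f₁ * f₁ - f₁ * b * e₀ * a * f₁
          - (f₁ * f₀ * y * a * f₁ + f₁ * (f₁ * y) * a * f₁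
            - f₁ * b * (e₀ * a * y) * a * f₁) := by rw [he₁.eq, hbea]; noncomm_ring
      _ = f₁ := by
        rw [heay, hf₁₀, hfy, hf₁.eq, hf₁.eq]
        noncomm_ring

/-- Exchange: a primitive summand of an idempotent equivalent to `∑ j, f j` with all `f j` primitive
is equivalent to some `f j` through the corresponding block of the equivalence. -/
theorem IdempotentIso.exists_block {R κ : Type*} [Ring R] [Finite R] [Fintype κ]
    {e₀ e₁ a b : R} {f : κ → R} (h : IdempotentIso (e₀ + e₁) (∑ j, f j) a b)
    (he₀ : IsPrimitiveIdempotent e₀) (he₀₁ : e₀ * e₁ = 0) (hf : ∀ j, IsPrimitiveIdempotent (f j)) :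
    ∃ j y, IdempotentIso e₀ (f j) (e₀ * a * f j) y := by
  have hee := he₀.isIdempotentElem.eq
  have hsum : ∑ j, e₀ * a * f j * b * e₀ = e₀ := by
    rw [← Finset.sum_mul, ← Finset.sum_mul, ← Finset.mul_sum, mul_assoc e₀, h.hom_mul_right,
      mul_assoc e₀, h.hom_mul_inv, mul_add, he₀₁, add_zero, hee, hee]
  obtain ⟨j, u, hul, hur, hxu, hux⟩ := he₀.exists_inverse_of_sum_eq
    (fun j => e₀ * a * f j * b * e₀) (fun j => by simp only [← mul_assoc, hee])
    (fun j => by simp only [mul_assoc, hee]) hsum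
  have hff := (hf j).isIdempotentElem.eq
  set x := e₀ * a * f j with hx
  set y := f j * b * u with hy
  have hex : e₀ * x = x := by simp only [hx, ← mul_assoc, hee]
  have hxf : x * f j = x := by simp only [hx, mul_assoc, hff]
  have hfy : f j * y = y := by simp only [hy, ← mul_assoc, hff]
  have hye : y * e₀ = y := by rw [hy, mul_assoc, hur]
  have hxy : x * y = e₀ := by
    rw [← hxu]
    simp only [hy, ← mul_assoc, hxf]
    rw [mul_assoc (x * b) e₀, hul]
  have hyx : y * x = 0 ∨ y * x = f j := by
    refine (hf j).eq_zero_or_eq _ ?_ (by rw [← mul_assoc, hfy]) (by rw [mul_assoc, hxf])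
    rw [IsIdempotentElem, mul_assoc y, ← mul_assoc x, hxy, hex]
  refine ⟨j, y, hex, hxf, hfy, hye, hxy, hyx.resolve_left fun h0 => he₀.ne_zero ?_⟩
  rw [← hee, ← hxy, mul_assoc x, ← mul_assoc y, h0, zero_mul, mul_zero]

theorem mul_sum_eq_zero_of_orthogonal {R : Type*} [Ring R] {k : ℕ} {e : Fin (k + 1) → R}
    (he : ∀ i i', i ≠ i' → e i * e i' = 0) (p : Fin (k + 1)) :
    e p * ∑ i, e (p.succAbove i) = 0 := by
  rw [Finset.mul_sum]
  exact Finset.sum_eq_zero fun i _ => he _ _ (p.succAbove_ne i).symm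

theorem sum_mul_eq_zero_of_orthogonal {R : Type*} [Ring R] {k : ℕ} {e : Fin (k + 1) → R}
    (he : ∀ i i', i ≠ i' → e i * e i' = 0) (p : Fin (k + 1)) :
    (∑ i, e (p.succAbove i)) * e p = 0 := by
  rw [Finset.sum_mul]
  exact Finset.sum_eq_zero fun i _ => he _ _ (p.succAbove_ne i)

theorem mul_sum_eq_self_of_orthogonal {R ι : Type*} [Ring R] [Fintype ι] {e : ι → R}
    (hidem : ∀ i, IsIdempotentElem (e i)) (he : ∀ i i', i ≠ i' → e i * e i' = 0) (i : ι) :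
    e i * ∑ i', e i' = e i := by
  rw [Finset.mul_sum, Fintype.sum_eq_single i fun i' hi' => he i i' hi'.symm, (hidem i).eq]

theorem isIdempotentElem_sum_of_orthogonal {R ι : Type*} [Ring R] [Fintype ι] {e : ι → R}
    (hidem : ∀ i, IsIdempotentElem (e i)) (he : ∀ i i', i ≠ i' → e i * e i' = 0) :
    IsIdempotentElem (∑ i, e i) := by
  rw [IsIdempotentElem, Finset.sum_mul]
  exact Finset.sum_congr rfl fun i _ => mul_sum_eq_self_of_orthogonal hidem he i

/-- Krull–Schmidt for idempotents of a finite ring. -/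
theorem IdempotentIso.exists_equiv {R : Type*} [Ring R] [Finite R] {k l : ℕ}
    {e : Fin k → R} {f : Fin l → R}
    (he : ∀ i, IsPrimitiveIdempotent (e i)) (hf : ∀ j, IsPrimitiveIdempotent (f j))
    (heorth : ∀ i i', i ≠ i' → e i * e i' = 0) (hforth : ∀ j j', j ≠ j' → f j * f j' = 0)
    {a b : R} (h : IdempotentIso (∑ i, e i) (∑ j, f j) a b) :
    ∃ σ : Fin k ≃ Fin l, ∀ i, ∃ a b, IdempotentIso (e i) (f (σ i)) a b := by
  induction k generalizing l a b with
  | zero =>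
    have hf0 : ∑ j, f j = 0 := by
      rw [← h.inv_mul_hom, ← h.inv_mul_left, Fin.sum_univ_zero, mul_zero, zero_mul]
    have : IsEmpty (Fin l) := ⟨fun j => (hf j).ne_zero <| by
      rw [← mul_sum_eq_self_of_orthogonal (fun j => (hf j).isIdempotentElem) hforth j, hf0,
        mul_zero]⟩
    exact ⟨Equiv.equivOfIsEmpty _ _, fun i => i.elim0⟩
  | succ k ih =>
    rw [Fin.sum_univ_succAbove e 0] at h
    obtain ⟨j, y, hy⟩ := h.exists_block (he 0) (mul_sum_eq_zero_of_orthogonal heorth 0) hf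
    obtain ⟨l, rfl⟩ : ∃ l', l = l' + 1 := Nat.exists_eq_succ_of_ne_zero j.pos.ne'
    rw [Fin.sum_univ_succAbove f j] at h
    have heorth' (i i' : Fin k) (hne : i ≠ i') :
        e ((0 : Fin (k + 1)).succAbove i) * e ((0 : Fin (k + 1)).succAbove i') = 0 :=
      heorth _ _ (Fin.succAbove_right_injective.ne hne)
    have hforth' (i i' : Fin l) (hne : i ≠ i') : f (j.succAbove i) * f (j.succAbove i') = 0 :=
      hforth _ _ (Fin.succAbove_right_injective.ne hne)
    obtain ⟨σ, hσ⟩ := ih (fun i => he _) (fun i => hf _) heorth' hforth'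
      (h.schurComplement
        (isIdempotentElem_sum_of_orthogonal (fun i => (he _).isIdempotentElem) heorth')
        (isIdempotentElem_sum_of_orthogonal (fun i => (hf _).isIdempotentElem) hforth')
        (mul_sum_eq_zero_of_orthogonal heorth 0) (sum_mul_eq_zero_of_orthogonal heorth 0)
        (sum_mul_eq_zero_of_orthogonal hforth j) hy)
    refine ⟨(finSuccEquiv' 0).trans (σ.optionCongr.trans (finSuccEquiv' j).symm), fun i => ?_⟩
    obtain rfl | ⟨i, rfl⟩ := Fin.eq_self_or_eq_succAbove 0 i
    · simpa using ⟨_, _, hy⟩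
    · simpa only [Equiv.trans_apply, finSuccEquiv'_succAbove, Equiv.optionCongr_apply,
        Option.map_some, finSuccEquiv'_symm_some] using hσ i

section Stabilizer

variable {F : Type*} [Field F] {m n : ℕ}

/-- The right stabilizer algebra as a subring. -/
def rightStabSubring (C : Submodule F (Matrix (Fin m) (Fin n) F)) :
    Subring (Matrix (Fin n) (Fin n) F) where
  carrier := rightStab C
  mul_mem' hM hN X hX := by
    rw [← Matrix.mul_assoc]
    exact hN _ (hM _ hX)
  one_mem' X hX := by rwa [Matrix.mul_one]
  add_mem' hM hN X hX := by
    rw [Matrix.mul_add]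
    exact C.add_mem (hM _ hX) (hN _ hX)
  zero_mem' X _ := by
    rw [Matrix.mul_zero]
    exact C.zero_mem
  neg_mem' hM X hX := by
    rw [Matrix.mul_neg]
    exact C.neg_mem (hM _ hX)

theorem IsMinIdemOfStab.isPrimitiveIdempotent {C : Submodule F (Matrix (Fin m) (Fin n) F)}
    {E : Matrix (Fin n) (Fin n) F} (hE : IsMinIdemOfStab C E) :
    IsPrimitiveIdempotent (⟨E, hE.1⟩ : rightStabSubring C) := by
  obtain ⟨hmem, hne, hidem, hmin⟩ := hE
  refine ⟨Subtype.ext hidem, fun h => hne (congrArg Subtype.val h), ?_⟩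
  rintro ⟨x, hx⟩ hxx hex hxe
  replace hxx : x * x = x := congrArg Subtype.val hxx
  replace hex : E * x = x := congrArg Subtype.val hex
  replace hxe : x * E = x := congrArg Subtype.val hxe
  by_contra! hcon
  refine hmin ⟨x, E - x, hx, (rightStabSubring C).sub_mem hmem hx,
    fun h => hcon.1 (Subtype.ext h), fun h => hcon.2 (Subtype.ext (sub_eq_zero.1 h).symm), hxx,
    ?_, ?_, ?_, ?_⟩
  · simp [mul_sub, sub_mul, hidem, hxx, hex, hxe]
  · simp [mul_sub, hxx, hxe]
  · simp [sub_mul, hxx, hex]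
  · simp

/-- Conjugation by `Q` identifies the right stabilizer algebras of `𝒞Q = 𝒟` and `𝒞`. -/
def rightStabConj {C D : Submodule F (Matrix (Fin m) (Fin n) F)} (Q : (Matrix (Fin n) (Fin n) F)ˣ)
    (hCQ : ∀ X ∈ C, X * Q.1 ∈ D) (hDQ : ∀ Y ∈ D, Y * Q⁻¹.1 ∈ C) :
    rightStabSubring D ≃+* rightStabSubring C where
  toFun M := ⟨Q * M * Q⁻¹.1, fun X hX => by
    rw [← Matrix.mul_assoc, ← Matrix.mul_assoc]
    exact hDQ _ (M.2 _ (hCQ _ hX))⟩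
  invFun M := ⟨Q⁻¹.1 * M * Q, fun Y hY => by
    rw [← Matrix.mul_assoc, ← Matrix.mul_assoc]
    exact hCQ _ (M.2 _ (hDQ _ hY))⟩
  left_inv M := Subtype.ext <| by simp [mul_assoc]
  right_inv M := Subtype.ext <| by simp [mul_assoc]
  map_mul' M N := Subtype.ext <| by simp [mul_assoc]
  map_add' M N := Subtype.ext <| by simp [mul_add, add_mul]

/-- An equivalence between the idempotents `A * Bᵀ` and `Q * (U * Vᵀ) * Q⁻¹` of the stabilizer of
`𝒞` gives a right equivalence between the pieces `𝒞A` and `𝒟U` of `𝒞` and `𝒟 = 𝒞Q`. -/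
theorem right_equivalent_of_equivalent_idempotents {C D : Submodule F (Matrix (Fin m) (Fin n) F)}
    {Q : (Matrix (Fin n) (Fin n) F)ˣ} (hCQ : ∀ X ∈ C, X * Q.1 ∈ D) (hDQ : ∀ Y ∈ D, Y * Q⁻¹.1 ∈ C)
    {E G a b : Matrix (Fin n) (Fin n) F} (ha : a ∈ rightStab C) (hb : b ∈ rightStab C)
    (hea : E * a = a) (haf : a * (Q.1 * G * Q⁻¹.1) = a) (hab : a * b = E)
    (hba : b * a = Q.1 * G * Q⁻¹.1) {r s : ℕ} {A B : Matrix (Fin n) (Fin r) F}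
    {U V : Matrix (Fin n) (Fin s) F} (hE : E = A * Bᵀ) (hBA : Bᵀ * A = 1) (hG : G = U * Vᵀ)
    (hVU : Vᵀ * U = 1) :
    r = s ∧ (∃ R' : Matrix (Fin s) (Fin r) F,
      (Bᵀ * a * Q.1 * U) * R' = 1 ∧ R' * (Bᵀ * a * Q.1 * U) = 1) ∧
      (fun Y => Y * (Bᵀ * a * Q.1 * U)) '' ((fun X => X * A) '' (C : Set (Matrix (Fin m) (Fin n) F)))
        = (fun X => X * U) '' (D : Set (Matrix (Fin m) (Fin n) F)) := by
  have hGU : G * U = U := by rw [hG, Matrix.mul_assoc, hVU, Matrix.mul_one]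
  have hVG : Vᵀ * G = Vᵀ := by rw [hG, ← Matrix.mul_assoc, hVU, Matrix.one_mul]
  have hAR : A * (Bᵀ * a * Q.1 * U) = a * Q.1 * U := by
    simp only [← Matrix.mul_assoc]
    rw [← hE, hea]
  have hRR' : (Bᵀ * a * Q.1 * U) * (Vᵀ * Q⁻¹.1 * b * A) = 1 := by
    calc _ = Bᵀ * (a * (Q.1 * (U * Vᵀ) * Q⁻¹.1)) * b * A := by simp only [Matrix.mul_assoc]
      _ = 1 := by
        rw [← hG, haf, Matrix.mul_assoc Bᵀ, hab, hE, ← Matrix.mul_assoc, hBA, Matrix.one_mul, hBA]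
  have hR'R : (Vᵀ * Q⁻¹.1 * b * A) * (Bᵀ * a * Q.1 * U) = 1 := by
    calc _ = Vᵀ * Q⁻¹.1 * b * (A * (Bᵀ * a * Q.1 * U)) := by simp only [Matrix.mul_assoc]
      _ = Vᵀ * Q⁻¹.1 * (b * a) * Q.1 * U := by rw [hAR]; simp only [Matrix.mul_assoc]
      _ = Vᵀ * (Q⁻¹.1 * Q.1) * G * (Q⁻¹.1 * Q.1) * U := by rw [hba]; simp only [Matrix.mul_assoc]
      _ = 1 := by rw [Q.inv_mul, Matrix.mul_one, Matrix.mul_one, hVG, hVU]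
  refine ⟨by simpa using Matrix.square_of_invertible _ _ hRR' hR'R, ⟨_, hRR', hR'R⟩, ?_⟩
  rw [Set.image_image]
  apply Set.Subset.antisymm
  · rintro _ ⟨X, hX, rfl⟩
    refine ⟨X * a * Q.1, hCQ _ (ha _ hX), ?_⟩
    simp only [Matrix.mul_assoc X, hAR]
  · rintro _ ⟨Y, hY, rfl⟩
    refine ⟨Y * Q⁻¹.1 * b, hb _ (hDQ _ hY), ?_⟩
    calc Y * Q⁻¹.1 * b * A * (Bᵀ * a * Q.1 * U)
        = Y * Q⁻¹.1 * b * (A * (Bᵀ * a * Q.1 * U)) := by simp only [Matrix.mul_assoc]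
      _ = Y * Q⁻¹.1 * (b * a) * Q.1 * U := by rw [hAR]; simp only [Matrix.mul_assoc]
      _ = Y * (Q⁻¹.1 * Q.1) * G * (Q⁻¹.1 * Q.1) * U := by rw [hba]; simp only [Matrix.mul_assoc]
      _ = Y * U := by
        rw [Q.inv_mul, Matrix.mul_one, Matrix.mul_one, Matrix.mul_assoc, hGU]

end Stabilizer

/-- Let 𝒞Q = 𝒟 with Q invertible.  Given decompositions of the
identity into pairwise orthogonal minimal idempotents Iₙ = E₁ + ⋯ + E_ℓ of
Stab_r(𝒞) and Iₙ = F₁ + ⋯ + F_{ℓ'} of Stab_r(𝒟), with factorizations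
E_i = A_i·B_iᵀ, F_j = U_j·V_jᵀ (full-rank factors, B_iᵀA_i = I, V_jᵀU_j = I),
we have ℓ = ℓ' and there is a permutation σ such that each 𝒞A_i is right
equivalent to 𝒟U_{σ(i)}; in particular rank(E_i) = rank(F_{σ(i)}). -/
theorem piecewise_right_equivalence_of_right_equivalence
    {Fq : Type*} [Field Fq] [Fintype Fq] {m n : ℕ}
    (C D : Submodule Fq (Matrix (Fin m) (Fin n) Fq))
    (Q : Matrix (Fin n) (Fin n) Fq) (hQ : IsUnit Q)
    (hCD : (fun X => X * Q) '' (C : Set (Matrix (Fin m) (Fin n) Fq))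
            = (D : Set (Matrix (Fin m) (Fin n) Fq)))
    (ℓ ℓ' : ℕ)
    (E : Fin ℓ → Matrix (Fin n) (Fin n) Fq) (G : Fin ℓ' → Matrix (Fin n) (Fin n) Fq)
    (hEmin : ∀ i, IsMinIdemOfStab C (E i)) (hGmin : ∀ j, IsMinIdemOfStab D (G j))
    (hEorth : ∀ i i', i ≠ i' → E i * E i' = 0)
    (hGorth : ∀ j j', j ≠ j' → G j * G j' = 0)
    (hEsum : (∑ i, E i) = 1) (hGsum : (∑ j, G j) = 1)
    (r : Fin ℓ → ℕ) (r' : Fin ℓ' → ℕ)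
    (hr : ∀ i, (E i).rank = r i) (hr' : ∀ j, (G j).rank = r' j)
    (A B : (i : Fin ℓ) → Matrix (Fin n) (Fin (r i)) Fq)
    (hArk : ∀ i, (A i).rank = r i) (hBrk : ∀ i, (B i).rank = r i)
    (hEfac : ∀ i, E i = A i * (B i)ᵀ) (hBA : ∀ i, (B i)ᵀ * A i = 1)
    (U V : (j : Fin ℓ') → Matrix (Fin n) (Fin (r' j)) Fq)
    (hUrk : ∀ j, (U j).rank = r' j) (hVrk : ∀ j, (V j).rank = r' j)
    (hGfac : ∀ j, G j = U j * (V j)ᵀ) (hVU : ∀ j, (V j)ᵀ * U j = 1) :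
    ℓ = ℓ' ∧ ∃ σ : Fin ℓ ≃ Fin ℓ', ∀ i : Fin ℓ,
      r i = r' (σ i) ∧
      ∃ R : Matrix (Fin (r i)) (Fin (r' (σ i))) Fq,
        (∃ R' : Matrix (Fin (r' (σ i))) (Fin (r i)) Fq, R * R' = 1 ∧ R' * R = 1) ∧
        (fun Y => Y * R) '' ((fun X => X * A i) '' (C : Set (Matrix (Fin m) (Fin n) Fq)))
          = (fun X => X * U (σ i)) '' (D : Set (Matrix (Fin m) (Fin n) Fq)) := by
  obtain ⟨Q, rfl⟩ := hQ
  have hCQ : ∀ X ∈ C, X * Q.1 ∈ D := fun X hX => (Set.ext_iff.1 hCD _).1 ⟨X, hX, rfl⟩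
  have hDQ : ∀ Y ∈ D, Y * Q⁻¹.1 ∈ C := fun Y hY => by
    obtain ⟨X, hX, rfl⟩ := (Set.ext_iff.1 hCD _).2 hY
    simpa [Matrix.mul_assoc] using hX
  let φ := rightStabConj Q hCQ hDQ
  let e (i : Fin ℓ) : rightStabSubring C := ⟨E i, (hEmin i).1⟩
  let g (j : Fin ℓ') : rightStabSubring D := ⟨G j, (hGmin j).1⟩
  have hesum : ∑ i, e i = 1 := Subtype.ext <| by simpa [e] using hEsum
  have hgsum : ∑ j, φ (g j) = 1 := by
    rw [← map_sum, show ∑ j, g j = 1 from Subtype.ext <| by simpa [g] using hGsum, map_one]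
  obtain ⟨σ, hσ⟩ := IdempotentIso.exists_equiv (e := e) (f := fun j => φ (g j)) (a := 1) (b := 1)
    (fun i => (hEmin i).isPrimitiveIdempotent) (fun j => (hGmin j).isPrimitiveIdempotent.map φ)
    (fun i i' hne => Subtype.ext (hEorth i i' hne))
    (fun j j' hne => by
      rw [← map_mul, show g j * g j' = 0 from Subtype.ext (hGorth j j' hne), map_zero])
    (by rw [hesum, hgsum]; constructor <;> exact mul_one 1)
  refine ⟨Fin.equiv_iff_eq.1 ⟨σ⟩, σ, fun i => ?_⟩
  obtain ⟨⟨a, ha⟩, ⟨b, hb⟩, h⟩ := hσ i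
  have hea : E i * a = a := congrArg Subtype.val h.left_mul_hom
  have haf : a * (Q.1 * G (σ i) * Q⁻¹.1) = a := congrArg Subtype.val h.hom_mul_right
  have hab : a * b = E i := congrArg Subtype.val h.hom_mul_inv
  have hba : b * a = Q.1 * G (σ i) * Q⁻¹.1 := congrArg Subtype.val h.inv_mul_hom
  obtain ⟨hsize, hR, himage⟩ := right_equivalent_of_equivalent_idempotents hCQ hDQ ha hb
    hea haf hab hba (hEfac i) (hBA i) (hGfac (σ i)) (hVU (σ i))
  exact ⟨hsize, _, hR, himage⟩
end

section
/- Let 𝒞, 𝒟 ⊆ M_{m×n}(𝔽_q) be matrix codes. Suppose Iₙ = E₁ + ⋯ + E_ℓ with E₁,…,E_ℓ pairwise orthogonal idempotents in Stab_r(𝒞) and Iₙ = F₁ + ⋯ + F_ℓ with F₁,…,F_ℓ pairwise orthogonal idempotents in Stab_r(𝒟). For each i, write E_i = A_i·B_iᵀ and F_i = U_i·V_iᵀ with A_i, B_i, U_i, V_i ∈ M_{n×r_i}(𝔽_q), B_iᵀA_i = I_{r_i} and V_iᵀU_i = I_{r_i}. If for every i ∈ {1,…,ℓ} there exists Q_i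 ∈ GL_{r_i}(𝔽_q) with 𝒞A_iQ_i = 𝒟U_i, then the matrix Q := Σ_{i=1}^{ℓ} A_i·Q_i·V_iᵀ is invertible, with inverse Σ_{i=1}^{ℓ} U_i·Q_i⁻¹·B_iᵀ, and 𝒞Q = 𝒟; in particular 𝒞 and 𝒟 are right equivalent. -/
open Matrix

section BlockFactorizations

variable {K : Type*} [CommRing K] {ν ι : Type*} [Fintype ν]
  {r : ι → ℕ}

/-- The factors of two orthogonal idempotents `U i * (V i)ᵀ` and `U j * (V j)ᵀ` are orthogonal. -/
theorem transpose_mul_eq_zero_of_orthogonal {U V : (i : ι) → Matrix ν (Fin (r i)) K}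
    (hVU : ∀ i, (V i)ᵀ * U i = 1) {i j : ι}
    (horth : (U i * (V i)ᵀ) * (U j * (V j)ᵀ) = 0) : (V i)ᵀ * U j = 0 := by
  calc (V i)ᵀ * U j = ((V i)ᵀ * U i) * ((V i)ᵀ * U j) * ((V j)ᵀ * U j) := by simp [hVU]
    _ = (V i)ᵀ * ((U i * (V i)ᵀ) * (U j * (V j)ᵀ)) * U j := by simp only [Matrix.mul_assoc]
    _ = 0 := by rw [horth]; simp

/-- Block sums with mutually inverse blocks `P i`, `R i`, glued along biorthogonal families
`V`, `U`, multiply to the identity. -/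
theorem blockSum_mul_blockSum_eq_one [DecidableEq ν] [Fintype ι]
    {A B U V : (i : ι) → Matrix ν (Fin (r i)) K}
    {P R : (i : ι) → Matrix (Fin (r i)) (Fin (r i)) K}
    (hsum : ∑ i, A i * (B i)ᵀ = 1) (hVU : ∀ i, (V i)ᵀ * U i = 1)
    (horth : ∀ i j, i ≠ j → (U i * (V i)ᵀ) * (U j * (V j)ᵀ) = 0)
    (hPR : ∀ i, P i * R i = 1) :
    (∑ i, A i * P i * (V i)ᵀ) * (∑ i, U i * R i * (B i)ᵀ) = 1 := by
  rw [Finset.sum_mul, ← hsum]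
  refine Finset.sum_congr rfl fun i _ => ?_
  rw [Finset.mul_sum, Finset.sum_eq_single i]
  · calc A i * P i * (V i)ᵀ * (U i * R i * (B i)ᵀ)
        = A i * (P i * ((V i)ᵀ * U i) * R i) * (B i)ᵀ := by simp only [Matrix.mul_assoc]
      _ = A i * (B i)ᵀ := by rw [hVU, Matrix.mul_one, hPR, Matrix.mul_one]
  · intro j _ hji
    calc A i * P i * (V i)ᵀ * (U j * R j * (B j)ᵀ)
        = A i * P i * ((V i)ᵀ * U j) * (R j * (B j)ᵀ) := by simp only [Matrix.mul_assoc]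
      _ = 0 := by
        rw [transpose_mul_eq_zero_of_orthogonal hVU (horth i j hji.symm)]; simp
  · simp

/-- If `X * S i` lies in `D * U i` for each `i` and `D` is stable under the `U i * (V i)ᵀ`,
then right multiplication by `∑ i, S i * (V i)ᵀ` maps `X` into `D`. -/
theorem mul_blockSum_mem [Fintype ι] {μ : Type*} {D : Submodule K (Matrix μ ν K)}
    {S U V : (i : ι) → Matrix ν (Fin (r i)) K}
    (hstab : ∀ i, ∀ Y ∈ D, Y * (U i * (V i)ᵀ) ∈ D) {X : Matrix μ ν K}
    (hX : ∀ i, ∃ Y ∈ D, Y * U i = X * S i) :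
    X * (∑ i, S i * (V i)ᵀ) ∈ D := by
  rw [Matrix.mul_sum]
  refine Submodule.sum_mem _ fun i _ => ?_
  obtain ⟨Y, hY, hYX⟩ := hX i
  rw [← Matrix.mul_assoc, ← hYX, Matrix.mul_assoc]
  exact hstab i Y hY

end BlockFactorizations

/-- Given decompositions Iₙ = E₁ + ⋯ + E_ℓ and Iₙ = F₁ + ⋯ + F_ℓ into
pairwise orthogonal idempotents of Stab_r(𝒞), resp. Stab_r(𝒟), with factorizations
E_i = A_iB_iᵀ, F_i = U_iV_iᵀ (B_iᵀA_i = I, V_iᵀU_i = I), if 𝒞A_iQ_i = 𝒟U_i for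
invertible Q_i, then Q := Σ A_iQ_iV_iᵀ is invertible with inverse Σ U_iQ_i⁻¹B_iᵀ
and 𝒞Q = 𝒟; in particular 𝒞 and 𝒟 are right equivalent. -/
theorem piecewise_to_global_right_equivalence
    {Fq : Type*} [Field Fq] [Fintype Fq] {m n : ℕ}
    (C D : Submodule Fq (Matrix (Fin m) (Fin n) Fq))
    (ℓ : ℕ) (r : Fin ℓ → ℕ)
    (E G : Fin ℓ → Matrix (Fin n) (Fin n) Fq)
    (hEstab : ∀ i, ∀ X ∈ C, X * E i ∈ C)
    (hGstab : ∀ i, ∀ X ∈ D, X * G i ∈ D)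
    (hEidem : ∀ i, E i * E i = E i) (hGidem : ∀ i, G i * G i = G i)
    (hEorth : ∀ i j, i ≠ j → E i * E j = 0)
    (hGorth : ∀ i j, i ≠ j → G i * G j = 0)
    (hEsum : (∑ i, E i) = 1) (hGsum : (∑ i, G i) = 1)
    (A B U V : (i : Fin ℓ) → Matrix (Fin n) (Fin (r i)) Fq)
    (hEfac : ∀ i, E i = A i * (B i)ᵀ) (hBA : ∀ i, (B i)ᵀ * A i = 1)
    (hGfac : ∀ i, G i = U i * (V i)ᵀ) (hVU : ∀ i, (V i)ᵀ * U i = 1)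
    (Qp : (i : Fin ℓ) → Matrix (Fin (r i)) (Fin (r i)) Fq)
    (hQp : ∀ i, IsUnit (Qp i))
    (hpiece : ∀ i, (fun X => X * (A i * Qp i)) '' (C : Set (Matrix (Fin m) (Fin n) Fq))
        = (fun X => X * U i) '' (D : Set (Matrix (Fin m) (Fin n) Fq))) :
    (∑ i, A i * Qp i * (V i)ᵀ) * (∑ i, U i * (Qp i)⁻¹ * (B i)ᵀ) = 1 ∧
    (∑ i, U i * (Qp i)⁻¹ * (B i)ᵀ) * (∑ i, A i * Qp i * (V i)ᵀ) = 1 ∧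
    (fun X => X * (∑ i, A i * Qp i * (V i)ᵀ)) '' (C : Set (Matrix (Fin m) (Fin n) Fq))
      = (D : Set (Matrix (Fin m) (Fin n) Fq)) := by
  obtain rfl : E = fun i => A i * (B i)ᵀ := funext hEfac
  obtain rfl : G = fun i => U i * (V i)ᵀ := funext hGfac
  have hdet : ∀ i, IsUnit (Qp i).det := fun i => (Matrix.isUnit_iff_isUnit_det _).1 (hQp i)
  have hinv := blockSum_mul_blockSum_eq_one hEsum hVU hGorth
    fun i => Matrix.mul_nonsing_inv (Qp i) (hdet i)
  have hinv' := blockSum_mul_blockSum_eq_one hGsum hBA hEorth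
    fun i => Matrix.nonsing_inv_mul (Qp i) (hdet i)
  refine ⟨hinv, hinv', Set.Subset.antisymm ?_ fun Y hY => ?_⟩
  · rintro _ ⟨X, hX, rfl⟩
    refine mul_blockSum_mem hGstab fun i => ?_
    exact (hpiece i).subset ⟨X, hX, rfl⟩
  · refine ⟨Y * ∑ i, U i * (Qp i)⁻¹ * (B i)ᵀ, mul_blockSum_mem hEstab fun i => ?_, ?_⟩
    · obtain ⟨X, hX, hXY⟩ := (hpiece i).superset ⟨Y, hY, rfl⟩
      refine ⟨X, hX, ?_⟩
      rw [← Matrix.mul_assoc, ← show X * (A i * Qp i) = Y * U i from hXY, Matrix.mul_assoc,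
        Matrix.mul_nonsing_inv_cancel_right _ _ (hdet i)]
    · change Y * _ * _ = Y
      rw [Matrix.mul_assoc, hinv', Matrix.mul_one]
end

section
/- Let 𝒞 ⊆ M_{m×n}(𝔽_q) be a matrix code and let E be a minimal idempotent of Stab_r(𝒞), written E = A·Bᵀ with A, B ∈ M_{n×r}(𝔽_q) full-rank, r = rank(E), and BᵀA = I_r. Then the right stabilizer algebra Stab_r(𝒞A) ⊆ M_{r×r}(𝔽_q) of the matrix code 𝒞A ⊆ M_{m×r}(𝔽_q) is local: the identity I_r cannot be written as a sum of two nonzero orthogonal idempotents of Stab_r(𝒞A). -/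
open Matrix

section Sandwich

variable {R : Type*} [CommRing R] {m n r : Type*} [Fintype n] [Fintype r]
  {A B : Matrix n r R}

theorem sandwich_mul_sandwich [DecidableEq r] (hBA : Bᵀ * A = 1) (e f : Matrix r r R) :
    A * e * Bᵀ * (A * f * Bᵀ) = A * (e * f) * Bᵀ := by
  calc A * e * Bᵀ * (A * f * Bᵀ) = A * e * (Bᵀ * A) * f * Bᵀ := by simp only [Matrix.mul_assoc]
    _ = A * (e * f) * Bᵀ := by rw [hBA, Matrix.mul_one, Matrix.mul_assoc A]

theorem sandwich_ne_zero [DecidableEq r] (hBA : Bᵀ * A = 1) {e : Matrix r r R} (he : e ≠ 0) :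
    A * e * Bᵀ ≠ 0 := by
  intro h
  apply he
  calc e = (Bᵀ * A) * e * (Bᵀ * A) := by rw [hBA, Matrix.one_mul, Matrix.mul_one]
    _ = Bᵀ * (A * e * Bᵀ) * A := by simp only [Matrix.mul_assoc]
    _ = 0 := by rw [h, Matrix.mul_zero, Matrix.zero_mul]

theorem mul_sandwich_mem {C : Set (Matrix m n R)} (hE : ∀ X ∈ C, X * (A * Bᵀ) ∈ C)
    {e : Matrix r r R}
    (he : ∀ Y ∈ (fun X => X * A) '' C, Y * e ∈ (fun X => X * A) '' C) :
    ∀ X ∈ C, X * (A * e * Bᵀ) ∈ C := by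
  intro X hX
  obtain ⟨Z, hZ, hZe⟩ := he _ ⟨X, hX, rfl⟩
  have h : X * (A * e * Bᵀ) = Z * (A * Bᵀ) := by
    rw [← Matrix.mul_assoc Z, show Z * A = X * A * e from hZe]
    simp only [Matrix.mul_assoc]
  exact h ▸ hE Z hZ

end Sandwich

/-- If E = ABᵀ is a minimal idempotent of Stab_r(𝒞) (A, B full-rank
n×r matrices with r = rank E and BᵀA = I_r), then the right stabilizer algebra of
the matrix code 𝒞A is local: I_r is not the sum of two nonzero orthogonal
idempotents of Stab_r(𝒞A). -/
theorem stabilizer_of_piece_is_local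
    {Fq : Type*} [Field Fq] [Fintype Fq] {m n r : ℕ}
    (C : Submodule Fq (Matrix (Fin m) (Fin n) Fq))
    (E : Matrix (Fin n) (Fin n) Fq)
    (hEstab : ∀ X ∈ C, X * E ∈ C)
    (hEidem : E * E = E) (hEne : E ≠ 0)
    (hEmin : ¬ ∃ E₁ E₂ : Matrix (Fin n) (Fin n) Fq,
        (∀ X ∈ C, X * E₁ ∈ C) ∧ (∀ X ∈ C, X * E₂ ∈ C) ∧ E₁ ≠ 0 ∧ E₂ ≠ 0 ∧
        E₁ * E₁ = E₁ ∧ E₂ * E₂ = E₂ ∧ E₁ * E₂ = 0 ∧ E₂ * E₁ = 0 ∧ E = E₁ + E₂)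
    (A B : Matrix (Fin n) (Fin r) Fq)
    (hArk : A.rank = r) (hBrk : B.rank = r) (hrE : E.rank = r)
    (hfac : E = A * Bᵀ) (hBA : Bᵀ * A = 1) :
    ¬ ∃ e₁ e₂ : Matrix (Fin r) (Fin r) Fq,
        (∀ Y ∈ (fun X => X * A) '' (C : Set (Matrix (Fin m) (Fin n) Fq)),
          Y * e₁ ∈ (fun X => X * A) '' (C : Set (Matrix (Fin m) (Fin n) Fq))) ∧
        (∀ Y ∈ (fun X => X * A) '' (C : Set (Matrix (Fin m) (Fin n) Fq)),
          Y * e₂ ∈ (fun X => X * A) '' (C : Set (Matrix (Fin m) (Fin n) Fq))) ∧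
        e₁ ≠ 0 ∧ e₂ ≠ 0 ∧ e₁ * e₁ = e₁ ∧ e₂ * e₂ = e₂ ∧
        e₁ * e₂ = 0 ∧ e₂ * e₁ = 0 ∧ e₁ + e₂ = 1 := by
  rintro ⟨e₁, e₂, h₁, h₂, hne₁, hne₂, hi₁, hi₂, h₁₂, h₂₁, hsum⟩
  subst hfac
  refine hEmin ⟨A * e₁ * Bᵀ, A * e₂ * Bᵀ, mul_sandwich_mem hEstab h₁, mul_sandwich_mem hEstab h₂,
    sandwich_ne_zero hBA hne₁, sandwich_ne_zero hBA hne₂, ?_, ?_, ?_, ?_, ?_⟩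
  · rw [sandwich_mul_sandwich hBA, hi₁]
  · rw [sandwich_mul_sandwich hBA, hi₂]
  · rw [sandwich_mul_sandwich hBA, h₁₂, Matrix.mul_zero, Matrix.zero_mul]
  · rw [sandwich_mul_sandwich hBA, h₂₁, Matrix.mul_zero, Matrix.zero_mul]
  · rw [← Matrix.add_mul, ← Matrix.mul_add, hsum, Matrix.mul_one]
end

section
/- Let A ∈ M_{m×m}(𝔽_q) be a matrix whose characteristic polynomial is irreducible over 𝔽_q. Then there exists a matrix Θ ∈ GL_m(𝔽_q) such that Θ^m = I_m and, for every B ∈ 𝔽_q[A], Θ·B·Θ⁻¹ = B^q (the q-th power of the matrix B). -/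
open Matrix in
/-- Conjugation by a suitable invertible matrix of order dividing `m` realizes the Frobenius
automorphism of any degree `m` extension of `F` represented by `m × m` matrices. -/
theorem Matrix.exists_mul_mul_inv_eq_pow_card_of_algHom
    {F K : Type*} [Field F] [Fintype F] [Field K] [Algebra F K] {m : ℕ} [NeZero m]
    (hK : Module.finrank F K = m) (φ : K →ₐ[F] Matrix (Fin m) (Fin m) F) :
    ∃ Θ : Matrix (Fin m) (Fin m) F, IsUnit Θ ∧ Θ ^ m = 1 ∧
      ∀ y : K, Θ * φ y * Θ⁻¹ = φ y ^ Fintype.card F := by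
  have : FiniteDimensional F K := .of_finrank_pos (hK ▸ Nat.pos_of_neZero m)
  have : Finite K := Module.finite_of_finite F
  obtain ⟨v, hv⟩ := exists_ne (0 : Fin m → F)
  let ev : K →ₗ[F] (Fin m → F) :=
    { toFun := fun x ↦ φ x *ᵥ v
      map_add' := fun x y ↦ by rw [map_add, add_mulVec]
      map_smul' := fun c x ↦ by rw [map_smul, smul_mulVec, RingHom.id_apply] }
  have ev_mul (x y : K) : ev (x * y) = φ x *ᵥ ev y := by
    change φ (x * y) *ᵥ v = φ x *ᵥ (φ y *ᵥ v)
    rw [map_mul, mulVec_mulVec]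
  have ev_inj : Function.Injective ev := by
    rw [injective_iff_map_eq_zero]
    intro x hx
    by_contra h
    apply hv
    have h1 := ev_mul x⁻¹ x
    rw [hx, mulVec_zero, inv_mul_cancel₀ h] at h1
    simpa [ev] using h1
  let e : K ≃ₗ[F] (Fin m → F) := LinearEquiv.ofInjectiveOfFinrankEq ev ev_inj (by simp [hK])
  have e_mul (x y : K) : e (x * y) = φ x *ᵥ e y := ev_mul x y
  let σ : K →ₗ[F] K := (FiniteField.frobeniusAlgHom F K).toLinearMap
  let Θ : Matrix (Fin m) (Fin m) F := LinearMap.toMatrix' (e.conj σ)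
  have hΘ : Θ ^ m = 1 := by
    have hσ : σ ^ m = 1 := by
      ext x
      have h := congr($(pow_orderOf_eq_one (FiniteField.frobeniusAlgHom F K)) x)
      rw [FiniteField.orderOf_frobeniusAlgHom, hK, AlgHom.coe_pow] at h
      rw [Module.End.pow_apply]
      exact h
    change (LinearMap.toMatrixAlgEquiv' (e.conjAlgEquiv F σ)) ^ m = 1
    rw [← map_pow, ← map_pow, hσ, map_one, map_one]
  have hΘu : IsUnit Θ := IsUnit.of_pow_eq_one hΘ (NeZero.ne m)
  have Θ_mulVec (x : K) : Θ *ᵥ e x = e (x ^ Fintype.card F) := by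
    rw [← toLin'_apply, toLin'_toMatrix']
    simp [LinearEquiv.conj_apply, σ]
  refine ⟨Θ, hΘu, hΘ, fun y ↦ ?_⟩
  have hcomm : Θ * φ y = φ y ^ Fintype.card F * Θ := by
    apply toLin'.injective
    refine LinearMap.ext fun w ↦ ?_
    obtain ⟨x, rfl⟩ := e.surjective w
    rw [toLin'_apply, toLin'_apply, ← mulVec_mulVec, ← mulVec_mulVec, ← e_mul, Θ_mulVec,
      Θ_mulVec, mul_pow, e_mul, map_pow]
  rw [hcomm, mul_assoc, mul_nonsing_inv _ ((isUnit_iff_isUnit_det _).mp hΘu), mul_one]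

/-- If A ∈ M_{m×m}(𝔽_q) has irreducible characteristic polynomial,
then there is Θ ∈ GL_m(𝔽_q) with Θ^m = I and Θ·B·Θ⁻¹ = B^q for all B ∈ 𝔽_q[A]. -/
theorem exists_frobenius_matrix
    {F : Type*} [Field F] [Fintype F] {m : ℕ}
    (A : Matrix (Fin m) (Fin m) F) (hirr : Irreducible A.charpoly) :
    ∃ Θ : Matrix (Fin m) (Fin m) F, IsUnit Θ ∧ Θ ^ m = 1 ∧
      ∀ B : Matrix (Fin m) (Fin m) F, (∃ p : Polynomial F, B = Polynomial.aeval A p) →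
        Θ * B * Θ⁻¹ = B ^ (Fintype.card F) := by
  have hdeg : A.charpoly.natDegree = m := by simp [Matrix.charpoly_natDegree_eq_dim]
  have : NeZero m := ⟨hdeg ▸ hirr.natDegree_pos.ne'⟩
  have : Fact (Irreducible A.charpoly) := ⟨hirr⟩
  have hK : Module.finrank F (AdjoinRoot A.charpoly) = m := by
    rw [(AdjoinRoot.powerBasis hirr.ne_zero).finrank, AdjoinRoot.powerBasis_dim, hdeg]
  let φ : AdjoinRoot A.charpoly →ₐ[F] Matrix (Fin m) (Fin m) F :=
    Ideal.Quotient.liftₐ _ (Polynomial.aeval A) fun p hp ↦ by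
      obtain ⟨r, rfl⟩ := Ideal.mem_span_singleton.mp hp
      rw [map_mul, Matrix.aeval_self_charpoly, zero_mul]
  obtain ⟨Θ, hu, hpow, hconj⟩ := Matrix.exists_mul_mul_inv_eq_pow_card_of_algHom hK φ
  refine ⟨Θ, hu, hpow, ?_⟩
  rintro _ ⟨p, rfl⟩
  exact hconj (AdjoinRoot.mk _ p)
end

section
/- Let A ∈ M_{m×m}(𝔽_q) have irreducible characteristic polynomial over 𝔽_q, and let Θ ∈ GL_m(𝔽_q) satisfy Θ^m = I_m and Θ·B·Θ⁻¹ = B^q for every B ∈ 𝔽_q[A]. Then every matrix Γ ∈ GL_m(𝔽_q) satisfying Γ·𝔽_q[A]·Γ⁻¹ = 𝔽_q[A] is of the form Γ = Θ^j·B for some j ∈ {0,…,m−1} and some invertible B ∈ 𝔽_q[A]. -/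
open scoped Matrix in
/-- The image of a field of degree `card n` in the `n × n` matrices is its own centralizer. -/
theorem Matrix.mem_range_of_commute_field {F L n : Type*} [Field F] [Field L] [Algebra F L]
    [Fintype n] [DecidableEq n] [Nonempty n] (φ : L →ₐ[F] Matrix n n F)
    (hdim : Module.finrank F L = Fintype.card n) (M : Matrix n n F)
    (hM : ∀ x, Commute M (φ x)) : ∃ x, φ x = M := by
  have : FiniteDimensional F L :=
    FiniteDimensional.of_finrank_pos (hdim ▸ Fintype.card_pos)
  let v : n → F := fun _ => 1
  have hv : v ≠ 0 := fun h => one_ne_zero (congrFun h (Classical.arbitrary n))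
  let ψ : L →ₗ[F] n → F := (Matrix.mulVecBilin F F).flip v ∘ₗ φ.toLinearMap
  have hψ (x : L) : ψ x = φ x *ᵥ v := rfl
  have hinj : Function.Injective ψ := by
    rw [injective_iff_map_eq_zero]
    intro x hx
    by_contra hx0
    apply hv
    calc v = φ (x⁻¹ * x) *ᵥ v := by rw [inv_mul_cancel₀ hx0, map_one, Matrix.one_mulVec]
      _ = φ x⁻¹ *ᵥ ψ x := by rw [hψ, map_mul, Matrix.mulVec_mulVec]
      _ = 0 := by rw [hx, Matrix.mulVec_zero]
  have hsurj : Function.Surjective ψ :=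
    (LinearMap.injective_iff_surjective_of_finrank_eq_finrank (by simpa using hdim)).mp hinj
  obtain ⟨x, hx⟩ := hsurj (M *ᵥ v)
  refine ⟨x, Matrix.ext_of_mulVec_single fun i => ?_⟩
  obtain ⟨y, hy⟩ := hsurj (Pi.single i 1)
  rw [← hy, hψ, Matrix.mulVec_mulVec, Matrix.mulVec_mulVec, ← map_mul, mul_comm x y,
    map_mul, (hM y).eq, ← Matrix.mulVec_mulVec, ← Matrix.mulVec_mulVec, ← hx, hψ]

/-- Conjugate elements of a finite field extension differ by a power of the Frobenius. -/
theorem IsConjRoot.exists_eq_pow_card_pow {F L : Type*} [Field F] [Fintype F] [Field L]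
    [Algebra F L] [FiniteDimensional F L] {x y : L} (h : IsConjRoot F x y) :
    ∃ j < Module.finrank F L, y = x ^ Fintype.card F ^ j := by
  have : Finite L := Module.finite_of_finite F
  obtain ⟨σ, hσ⟩ := isConjRoot_iff_exists_algEquiv.mp h.symm
  obtain ⟨j, rfl⟩ := (FiniteField.bijective_frobeniusAlgEquivOfAlgebraic_pow F L).2 σ
  refine ⟨j, j.2, ?_⟩
  rw [← hσ]
  simp [FiniteField.coe_frobeniusAlgEquivOfAlgebraic_iterate]

/-- If `t` conjugates `b` to its `q`-th power, then `t ^ j` conjugates `b` to its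
`q ^ j`-th power. -/
theorem SemiconjBy.pow_left_pow_pow {R : Type*} [Monoid R] {t b : R} {q : ℕ}
    (h : SemiconjBy t b (b ^ q)) (j : ℕ) : SemiconjBy (t ^ j) b (b ^ q ^ j) := by
  induction j with
  | zero => simp
  | succ j ih =>
    rw [pow_succ' t, pow_succ' q, pow_mul]
    exact (h.pow_right (q ^ j)).mul_left ih

/-- Let A have irreducible characteristic polynomial and Θ ∈ GL_m
satisfy Θ^m = I and Θ·B·Θ⁻¹ = B^q on 𝔽_q[A].  Then every Γ ∈ GL_m(𝔽_q)
normalizing 𝔽_q[A] (i.e. Γ·𝔽_q[A]·Γ⁻¹ = 𝔽_q[A]) has the form Γ = Θ^j·B for some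
j ∈ {0,…,m−1} and some invertible B ∈ 𝔽_q[A]. -/
theorem normalizer_of_field_representation
    {F : Type*} [Field F] [Fintype F] {m : ℕ}
    (A : Matrix (Fin m) (Fin m) F) (hirr : Irreducible A.charpoly)
    (Θ : Matrix (Fin m) (Fin m) F) (hΘu : IsUnit Θ) (hΘm : Θ ^ m = 1)
    (hΘfrob : ∀ B : Matrix (Fin m) (Fin m) F,
      (∃ p : Polynomial F, B = Polynomial.aeval A p) →
        Θ * B * Θ⁻¹ = B ^ (Fintype.card F))
    (Γ : Matrix (Fin m) (Fin m) F) (hΓ : IsUnit Γ)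
    (hnorm : (fun M => Γ * M * Γ⁻¹) '' {M : Matrix (Fin m) (Fin m) F | ∃ p : Polynomial F, M = Polynomial.aeval A p}
      = {M : Matrix (Fin m) (Fin m) F | ∃ p : Polynomial F, M = Polynomial.aeval A p}) :
    ∃ j : ℕ, j < m ∧ ∃ p : Polynomial F,
      IsUnit (Polynomial.aeval A p : Matrix (Fin m) (Fin m) F) ∧
      Γ = Θ ^ j * Polynomial.aeval A p := by
  have : Fact (Irreducible A.charpoly) := ⟨hirr⟩
  have hmonic := A.charpoly_monic
  have hdeg : A.charpoly.natDegree = m := by simp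
  have hm : 0 < m := hdeg ▸ hirr.natDegree_pos
  have : NeZero m := ⟨hm.ne'⟩
  have hΓ' : IsUnit Γ.det := (Matrix.isUnit_iff_isUnit_det Γ).mp hΓ
  have hΘ' : IsUnit Θ.det := (Matrix.isUnit_iff_isUnit_det Θ).mp hΘu
  let L := AdjoinRoot A.charpoly
  have : FiniteDimensional F L := hmonic.finite_adjoinRoot
  have hrank : Module.finrank F L = m := by
    rw [(AdjoinRoot.powerBasis hirr.ne_zero).finrank, AdjoinRoot.powerBasis_dim, hdeg]
  let φ : L →ₐ[F] Matrix (Fin m) (Fin m) F :=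
    Ideal.Quotient.liftₐ _ (Polynomial.aeval A) fun f hf => by
      obtain ⟨g, rfl⟩ := Ideal.mem_span_singleton.mp hf
      rw [map_mul, A.aeval_self_charpoly, zero_mul]
  have hφ (p : Polynomial F) : φ (AdjoinRoot.mk A.charpoly p) = Polynomial.aeval A p :=
    rfl
  have hφroot : φ (AdjoinRoot.root A.charpoly) = A := by
    rw [← AdjoinRoot.mk_X, hφ, Polynomial.aeval_X]
  obtain ⟨p, hp⟩ : Γ * A * Γ⁻¹ ∈ {M | ∃ p : Polynomial F, M = Polynomial.aeval A p} :=
    hnorm ▸ ⟨A, ⟨Polynomial.X, by simp⟩, rfl⟩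
  have hconj : IsConjRoot F (AdjoinRoot.root A.charpoly) (AdjoinRoot.mk A.charpoly p) := by
    refine (minpoly.eq_of_irreducible_of_monic hirr ?_ hmonic).symm.trans
      (minpoly.eq_of_irreducible_of_monic hirr ?_ hmonic)
    · exact (AdjoinRoot.aeval_eq _).trans AdjoinRoot.mk_self
    · apply φ.toRingHom.injective
      change φ _ = φ _
      rw [← Polynomial.aeval_algHom_apply, hφ, ← hp, map_zero]
      obtain ⟨u, rfl⟩ := hΓ
      rw [← Matrix.charpoly_units_conj u A]
      exact Matrix.aeval_self_charpoly _
  obtain ⟨j, hj, hroot⟩ := hconj.exists_eq_pow_card_pow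
  have hΓA : Γ * A = A ^ Fintype.card F ^ j * Γ := by
    have h := congrArg φ hroot
    rw [map_pow, hφ, hφroot, ← hp] at h
    rw [← h, Matrix.nonsing_inv_mul_cancel_right _ _ hΓ']
  have hΘA : SemiconjBy (Θ ^ j) A (A ^ Fintype.card F ^ j) := by
    refine SemiconjBy.pow_left_pow_pow ?_ j
    rw [SemiconjBy, ← hΘfrob A ⟨Polynomial.X, by simp⟩, Matrix.nonsing_inv_mul_cancel_right _ _ hΘ']
  obtain ⟨T, hT⟩ := hΘu.pow j
  rw [← hT] at hΘA
  have hcomm : Commute (T⁻¹.val * Γ) A :=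
    hΘA.units_inv_symm_left.mul_left hΓA
  obtain ⟨x, hx⟩ := Matrix.mem_range_of_commute_field φ (by simpa using hrank) (T⁻¹.val * Γ)
    fun x => by
      obtain ⟨f, rfl⟩ := AdjoinRoot.mk_surjective x
      rw [hφ]
      exact Algebra.commute_of_mem_adjoin_of_forall_mem_commute
        (Polynomial.aeval_mem_adjoin_singleton F A) (by simpa using hcomm)
  obtain ⟨f, rfl⟩ := AdjoinRoot.mk_surjective x
  rw [hφ] at hx
  refine ⟨j, hrank ▸ hj, f, hx ▸ T⁻¹.isUnit.mul hΓ, ?_⟩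
  rw [hx, ← hT, Units.mul_inv_cancel_left]
end

section
/- Let S₁, S₂ ⊆ M_{m×m}(𝔽_q) be two 𝔽_q-subalgebras, each of which is isomorphic as an 𝔽_q-algebra to the finite field 𝔽_{q^m} with q^m elements. Then there exists P ∈ GL_m(𝔽_q) such that S₁ = P⁻¹·S₂·P. -/
open Polynomial

namespace AlgHom

variable {F K : Type*} [Field F] [Field K] [Algebra F K] {m : ℕ}

/-- The orbit map of a nonzero vector under a representation of an extension field whose degree
equals the dimension of the representation, as a linear equivalence. -/
noncomputable def orbitEquiv [FiniteDimensional F K] (hK : Module.finrank F K = m)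
    (σ : K →ₐ[F] Matrix (Fin m) (Fin m) F) {v : Fin m → F} (hv : v ≠ 0) :
    K ≃ₗ[F] (Fin m → F) :=
  LinearEquiv.ofInjectiveOfFinrankEq
    { toFun := fun k => (σ k).mulVec v
      map_add' := fun x y => by rw [map_add, Matrix.add_mulVec]
      map_smul' := fun c x => by rw [map_smul, Matrix.smul_mulVec, RingHom.id_apply] }
    (by
      rw [injective_iff_map_eq_zero]
      intro k hk
      by_contra hne
      refine hv ?_
      have hk : (σ k).mulVec v = 0 := hk
      rw [← Matrix.one_mulVec v, ← map_one σ, ← inv_mul_cancel₀ hne, map_mul,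
        ← Matrix.mulVec_mulVec, hk, Matrix.mulVec_zero])
    (by rw [hK, Module.finrank_fin_fun])

theorem orbitEquiv_apply [FiniteDimensional F K] (hK : Module.finrank F K = m)
    (σ : K →ₐ[F] Matrix (Fin m) (Fin m) F) {v : Fin m → F} (hv : v ≠ 0) (k : K) :
    orbitEquiv hK σ hv k = (σ k).mulVec v :=
  rfl

/-- Two representations of an extension field of degree `m` by `m × m` matrices are conjugate. -/
theorem exists_isUnit_matrix_conj [FiniteDimensional F K] (hK : Module.finrank F K = m)
    (σ τ : K →ₐ[F] Matrix (Fin m) (Fin m) F) :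
    ∃ P : Matrix (Fin m) (Fin m) F, IsUnit P ∧ ∀ k, σ k = P⁻¹ * τ k * P := by
  have : NeZero m := ⟨hK ▸ Module.finrank_pos.ne'⟩
  obtain ⟨v, hv⟩ := exists_ne (0 : Fin m → F)
  let e := (orbitEquiv hK σ hv).symm.trans (orbitEquiv hK τ hv)
  have hP : IsUnit (LinearMap.toMatrix' (e : (Fin m → F) →ₗ[F] (Fin m → F))) := by
    rw [Matrix.isUnit_iff_isUnit_det, LinearMap.det_toMatrix']
    exact e.isUnit_det'
  refine ⟨_, hP, fun k => ?_⟩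
  rw [mul_assoc, Matrix.isUnit_iff_isUnit_det] at *
  rw [← Matrix.nonsing_inv_mul_cancel_left _ (σ k) hP]
  congr 1
  refine Matrix.toLin'.injective (LinearMap.ext fun w => ?_)
  obtain ⟨l, rfl⟩ := (orbitEquiv hK σ hv).surjective w
  have h : (σ k).mulVec (orbitEquiv hK σ hv l) = orbitEquiv hK σ hv (k * l) := by
    simp [orbitEquiv_apply]
  simp only [Matrix.toLin'_mul, LinearMap.comp_apply, Matrix.toLin'_toMatrix',
    Matrix.toLin'_apply, h, e, LinearEquiv.coe_coe, LinearEquiv.trans_apply,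
    LinearEquiv.symm_apply_apply]
  simp [orbitEquiv_apply]

end AlgHom

/-- The representation of `F[X] / (charpoly A)` sending the root to `A`. -/
noncomputable def Matrix.adjoinRootCharpolyHom {F : Type*} [Field F] {m : ℕ}
    (A : Matrix (Fin m) (Fin m) F) : AdjoinRoot A.charpoly →ₐ[F] Matrix (Fin m) (Fin m) F :=
  Ideal.Quotient.liftₐ _ (aeval A) fun p hp => by
    obtain ⟨q, rfl⟩ := Ideal.mem_span_singleton.mp hp
    rw [map_mul, Matrix.aeval_self_charpoly, zero_mul]

theorem Matrix.range_adjoinRootCharpolyHom {F : Type*} [Field F] {m : ℕ}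
    (A : Matrix (Fin m) (Fin m) F) :
    Set.range A.adjoinRootCharpolyHom = {M | ∃ p : F[X], M = aeval A p} := by
  ext M
  rw [← AdjoinRoot.mk_surjective.range_comp]
  exact exists_congr fun p => eq_comm

theorem Matrix.finrank_adjoinRoot_charpoly {F : Type*} [Field F] {m : ℕ}
    (A : Matrix (Fin m) (Fin m) F) : Module.finrank F (AdjoinRoot A.charpoly) = m := by
  rw [(AdjoinRoot.powerBasis A.charpoly_monic.ne_zero).finrank, AdjoinRoot.powerBasis_dim,
    Matrix.charpoly_natDegree_eq_dim, Fintype.card_fin]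

/-- Two subalgebras S₁, S₂ ⊆ M_{m×m}(𝔽_q), each a representation of
𝔽_{q^m} (i.e. spanned as an algebra by a matrix with irreducible characteristic
polynomial, equivalently isomorphic to 𝔽_{q^m} as an 𝔽_q-algebra), are conjugate:
S₁ = P⁻¹·S₂·P for some P ∈ GL_m(𝔽_q). -/
theorem representations_of_Fqm_are_conjugate
    {F : Type*} [Field F] [Fintype F] {m : ℕ}
    (S₁ S₂ : Set (Matrix (Fin m) (Fin m) F))
    (hS₁ : ∃ A₁ : Matrix (Fin m) (Fin m) F, Irreducible A₁.charpoly ∧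
      S₁ = {M | ∃ p : Polynomial F, M = Polynomial.aeval A₁ p})
    (hS₂ : ∃ A₂ : Matrix (Fin m) (Fin m) F, Irreducible A₂.charpoly ∧
      S₂ = {M | ∃ p : Polynomial F, M = Polynomial.aeval A₂ p}) :
    ∃ P : Matrix (Fin m) (Fin m) F, IsUnit P ∧
      S₁ = (fun M => P⁻¹ * M * P) '' S₂ := by
  obtain ⟨A₁, h₁, rfl⟩ := hS₁
  obtain ⟨A₂, h₂, rfl⟩ := hS₂
  have := Fact.mk h₁
  have := Fact.mk h₂
  have : FiniteDimensional F (AdjoinRoot A₁.charpoly) :=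
    (AdjoinRoot.powerBasis h₁.ne_zero).finite
  have : FiniteDimensional F (AdjoinRoot A₂.charpoly) :=
    (AdjoinRoot.powerBasis h₂.ne_zero).finite
  have := Module.finite_of_finite F (M := AdjoinRoot A₂.charpoly)
  have hdim : Module.finrank F (AdjoinRoot A₁.charpoly) =
      Module.finrank F (AdjoinRoot A₂.charpoly) := by
    rw [A₁.finrank_adjoinRoot_charpoly, A₂.finrank_adjoinRoot_charpoly]
  obtain ⟨φ⟩ := FiniteField.nonempty_algHom_of_finrank_dvd hdim.dvd
  have hφ : Function.Surjective φ :=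
    (LinearMap.injective_iff_surjective_of_finrank_eq_finrank (f := φ.toLinearMap) hdim).mp
      φ.injective
  obtain ⟨P, hP, h⟩ := AlgHom.exists_isUnit_matrix_conj A₁.finrank_adjoinRoot_charpoly
    A₁.adjoinRootCharpolyHom (A₂.adjoinRootCharpolyHom.comp φ)
  refine ⟨P, hP, ?_⟩
  rw [← A₁.range_adjoinRootCharpolyHom, ← A₂.range_adjoinRootCharpolyHom,
    ← hφ.range_comp, ← Set.range_comp]
  exact congrArg Set.range (funext h)
end

section
/- Let 𝒞, 𝒟 ⊆ M_{m×n}(𝔽_q) be matrix codes that are equivalent, i.e., 𝒞 = S·𝒟·T for some S ∈ GL_m(𝔽_q) and T ∈ GL_n(𝔽_q). Suppose their left stabilizer algebras are equal and that this common algebra equals 𝔽_q[A] for some A ∈ M_{m×m}(𝔽_q) whose characteristic polynomial is irreducible over 𝔽_q. Then, for any Θ ∈ GL_m(𝔽_q) satisfying Θ^m = I_m and Θ·B·Θ⁻¹ = B^q for all B ∈ 𝔽_q[A], there exists j ∈ {0,…,m−1} such that 𝒞 is right equivalent to Θ^j·𝒟. -/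
open Polynomial Matrix

section IrreducibleCharpoly

variable {F : Type*} [Field F] {m : ℕ} {A : Matrix (Fin m) (Fin m) F}

/-- Evaluation of polynomials at `A` factors through `F[X] / (A.charpoly)`. -/
theorem exists_algHom_adjoinRoot_charpoly (A : Matrix (Fin m) (Fin m) F) :
    ∃ φ : AdjoinRoot A.charpoly →ₐ[F] Matrix (Fin m) (Fin m) F,
      ∀ p : F[X], φ (AdjoinRoot.mk A.charpoly p) = aeval A p := by
  refine ⟨Ideal.Quotient.liftₐ (Ideal.span {A.charpoly}) (aeval A) fun a ha => ?_, fun p => rfl⟩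
  obtain ⟨b, rfl⟩ := Ideal.mem_span_singleton.1 ha
  rw [map_mul, aeval_self_charpoly, zero_mul]

/-- A matrix commuting with a matrix `A` of irreducible characteristic polynomial is a
polynomial in `A`. -/
theorem exists_aeval_eq_of_commute_of_irreducible_charpoly (hirr : Irreducible A.charpoly)
    {P : Matrix (Fin m) (Fin m) F} (hP : Commute P A) : ∃ p : F[X], P = aeval A p := by
  have : Fact (Irreducible A.charpoly) := ⟨hirr⟩
  have hm : 0 < m := by
    have := hirr.natDegree_pos
    rwa [A.charpoly_natDegree_eq_dim, Fintype.card_fin] at this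
  obtain ⟨φ, hφ⟩ := exists_algHom_adjoinRoot_charpoly A
  let v : Fin m → F := Pi.single ⟨0, hm⟩ 1
  have hv : v ≠ 0 := by simp [v]
  let L : AdjoinRoot A.charpoly →ₗ[F] (Fin m → F) :=
    (LinearMap.applyₗ v) ∘ₗ (Matrix.toLin' : _ ≃ₗ[F] _).toLinearMap ∘ₗ φ.toLinearMap
  have hL (x) : L x = φ x *ᵥ v := by simp [L]
  have hinj : Function.Injective L := by
    rw [injective_iff_map_eq_zero]
    intro x hx
    by_contra hne
    apply hv
    rw [hL] at hx
    rw [← one_mulVec v, ← map_one φ, ← inv_mul_cancel₀ hne, map_mul, ← mulVec_mulVec, hx,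
      mulVec_zero]
  have hrank : Module.finrank F (AdjoinRoot A.charpoly) = Module.finrank F (Fin m → F) := by
    rw [(AdjoinRoot.powerBasis hirr.ne_zero).finrank, AdjoinRoot.powerBasis_dim,
      A.charpoly_natDegree_eq_dim, Module.finrank_fintype_fun_eq_card]
  have : FiniteDimensional F (AdjoinRoot A.charpoly) :=
    (AdjoinRoot.powerBasis hirr.ne_zero).finite
  have hsurj : Function.Surjective L :=
    (LinearMap.injective_iff_surjective_of_finrank_eq_finrank hrank).1 hinj
  have hrep (w : Fin m → F) : ∃ p : F[X], aeval A p *ᵥ v = w := by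
    obtain ⟨x, hx⟩ := hsurj w
    obtain ⟨p, rfl⟩ := AdjoinRoot.mk_surjective x
    exact ⟨p, by rw [← hφ, ← hL, hx]⟩
  obtain ⟨p, hp⟩ := hrep (P *ᵥ v)
  refine ⟨p, Matrix.toLin'.injective (LinearMap.ext fun w => ?_)⟩
  obtain ⟨r, rfl⟩ := hrep w
  have hPr : P * aeval A r = aeval A r * P := by
    induction r using Polynomial.induction_on' with
    | add p q hp hq => rw [map_add, mul_add, add_mul, hp, hq]
    | monomial k a =>
      rw [aeval_monomial]
      exact (Algebra.commute_algebraMap_right a P).mul_right (hP.pow_right k)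
  simp only [toLin'_apply, mulVec_mulVec]
  rw [hPr, ← mulVec_mulVec, ← hp, mulVec_mulVec, ← map_mul, ← map_mul, mul_comm]

/-- Over a field with `q` elements, if the characteristic polynomial of `A` is irreducible, then
each of its roots in `F[A]` is `A ^ q ^ i` for some `i`. -/
theorem exists_aeval_eq_pow_card_pow_of_irreducible_charpoly [Fintype F]
    (hirr : Irreducible A.charpoly) {p : F[X]}
    (hp : aeval (aeval A p) A.charpoly = 0) :
    ∃ i < m, aeval A p = A ^ Fintype.card F ^ i := by
  have : Fact (Irreducible A.charpoly) := ⟨hirr⟩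
  have hm : 0 < m := by
    have := hirr.natDegree_pos
    rwa [A.charpoly_natDegree_eq_dim, Fintype.card_fin] at this
  have : Nonempty (Fin m) := ⟨⟨0, hm⟩⟩
  obtain ⟨φ, hφ⟩ := exists_algHom_adjoinRoot_charpoly A
  have hrank : Module.finrank F (AdjoinRoot A.charpoly) = m := by
    rw [(AdjoinRoot.powerBasis hirr.ne_zero).finrank, AdjoinRoot.powerBasis_dim,
      A.charpoly_natDegree_eq_dim, Fintype.card_fin]
  have : FiniteDimensional F (AdjoinRoot A.charpoly) :=
    (AdjoinRoot.powerBasis hirr.ne_zero).finite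
  have : Finite (AdjoinRoot A.charpoly) := Module.finite_of_finite F
  have hroot : aeval (AdjoinRoot.mk A.charpoly p) A.charpoly = 0 := by
    apply φ.toRingHom.injective
    change φ _ = φ 0
    rw [map_zero, ← aeval_algHom_apply, hφ, hp]
  let σ : AdjoinRoot A.charpoly →ₐ[F] AdjoinRoot A.charpoly :=
    AdjoinRoot.liftAlgHom A.charpoly (Algebra.ofId F _) (AdjoinRoot.mk A.charpoly p) hroot
  obtain ⟨⟨i, hi⟩, hσ⟩ :=
    (FiniteField.bijective_frobeniusAlgHom_pow F (AdjoinRoot A.charpoly)).2 σ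
  refine ⟨i, hrank ▸ hi, ?_⟩
  have h1 : σ (AdjoinRoot.root _) = AdjoinRoot.mk A.charpoly p := AdjoinRoot.liftAlgHom_root ..
  have h2 : σ (AdjoinRoot.root _) = AdjoinRoot.root A.charpoly ^ Fintype.card F ^ i := by
    rw [← hσ]
    simp [AlgHom.coe_pow, FiniteField.coe_frobeniusAlgHom, pow_iterate]
  rw [← hφ, ← h1, h2, map_pow, ← AdjoinRoot.mk_X, hφ, aeval_X]

end IrreducibleCharpoly

theorem pow_mul_eq_pow_pow_mul {R : Type*} [Monoid R] {t a : R} {q : ℕ}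
    (h : ∀ k : ℕ, t * a ^ k = (a ^ k) ^ q * t) (i : ℕ) : t ^ i * a = a ^ q ^ i * t ^ i := by
  induction i with
  | zero => simp
  | succ i ih => rw [pow_succ', mul_assoc, ih, ← mul_assoc, h, ← pow_mul, ← pow_succ, mul_assoc]


/-- Let 𝒞 = S·𝒟·T for S ∈ GL_m(𝔽_q), T ∈ GL_n(𝔽_q), and suppose
Stab_l(𝒞) = Stab_l(𝒟) = 𝔽_q[A] with A having irreducible characteristic
polynomial.  Then for any Θ ∈ GL_m(𝔽_q) with Θ^m = I and Θ·B·Θ⁻¹ = B^q on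
𝔽_q[A], there is j ∈ {0,…,m−1} such that 𝒞 is right equivalent to Θ^j·𝒟. -/
theorem equivalent_with_field_stabilizer_right_equivalent
    {F : Type*} [Field F] [Fintype F] {m n : ℕ}
    (C D : Submodule F (Matrix (Fin m) (Fin n) F))
    (S : Matrix (Fin m) (Fin m) F) (hS : IsUnit S)
    (T : Matrix (Fin n) (Fin n) F) (hT : IsUnit T)
    (hCD : (C : Set (Matrix (Fin m) (Fin n) F))
      = (fun X => S * X * T) '' (D : Set (Matrix (Fin m) (Fin n) F)))
    (A : Matrix (Fin m) (Fin m) F) (hirr : Irreducible A.charpoly)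
    (hstabC : {M : Matrix (Fin m) (Fin m) F | ∀ X ∈ C, M * X ∈ C}
      = {M : Matrix (Fin m) (Fin m) F | ∃ p : Polynomial F, M = Polynomial.aeval A p})
    (hstabD : {M : Matrix (Fin m) (Fin m) F | ∀ X ∈ D, M * X ∈ D}
      = {M : Matrix (Fin m) (Fin m) F | ∃ p : Polynomial F, M = Polynomial.aeval A p})
    (Θ : Matrix (Fin m) (Fin m) F) (hΘu : IsUnit Θ) (hΘm : Θ ^ m = 1)
    (hΘfrob : ∀ B : Matrix (Fin m) (Fin m) F,
      (∃ p : Polynomial F, B = Polynomial.aeval A p) →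
        Θ * B * Θ⁻¹ = B ^ (Fintype.card F)) :
    ∃ j : ℕ, j < m ∧ ∃ Q : Matrix (Fin n) (Fin n) F, IsUnit Q ∧
      (fun X => X * Q) '' (C : Set (Matrix (Fin m) (Fin n) F))
        = (fun X => Θ ^ j * X) '' (D : Set (Matrix (Fin m) (Fin n) F)) := by
  have hΘdet := (isUnit_iff_isUnit_det Θ).1 hΘu
  have hSdet := (isUnit_iff_isUnit_det S).1 hS
  have hTdet := (isUnit_iff_isUnit_det T).1 hT
  have hAD : ∀ X ∈ D, A * X ∈ D := by
    have : A ∈ {M : Matrix (Fin m) (Fin m) F | ∀ X ∈ D, M * X ∈ D} := by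
      rw [hstabD]
      exact ⟨X, by simp⟩
    exact this
  have hmemC (Y) : Y ∈ C ↔ ∃ X ∈ D, S * X * T = Y := by
    rw [← SetLike.mem_coe, hCD]
    rfl
  obtain ⟨p, hp⟩ : ∃ p : F[X], S * A * S⁻¹ = aeval A p := by
    have : S * A * S⁻¹ ∈ {M : Matrix (Fin m) (Fin m) F | ∀ X ∈ C, M * X ∈ C} := by
      intro Y hY
      obtain ⟨X, hX, rfl⟩ := (hmemC Y).1 hY
      refine (hmemC _).2 ⟨A * X, hAD X hX, ?_⟩
      simp only [Matrix.mul_assoc]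
      rw [nonsing_inv_mul_cancel_left _ _ hSdet]
    rwa [hstabC] at this
  have hroot : aeval (aeval A p) A.charpoly = 0 := by
    have hcp : (S * A * S⁻¹).charpoly = A.charpoly := by
      obtain ⟨u, rfl⟩ := hS
      exact charpoly_units_conj u A
    rw [← hp, ← hcp, aeval_self_charpoly]
  obtain ⟨i, hi, hpow⟩ := exists_aeval_eq_pow_card_pow_of_irreducible_charpoly hirr hroot
  have hSA : S * A = A ^ Fintype.card F ^ i * S := by
    rw [← hpow, ← hp, nonsing_inv_mul_cancel_right _ _ hSdet]
  have hΘA : Θ ^ i * A = A ^ Fintype.card F ^ i * Θ ^ i :=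
    pow_mul_eq_pow_pow_mul (fun k => by
      rw [← hΘfrob (A ^ k) ⟨X ^ k, by simp⟩, nonsing_inv_mul_cancel_right _ _ hΘdet]) i
  obtain ⟨P, hP⟩ : ∃ P, Θ ^ i * P = S := by
    obtain ⟨u, hu⟩ := hΘu.pow i
    exact ⟨(u⁻¹ : (Matrix (Fin m) (Fin m) F)ˣ).val * S, by rw [← hu, Units.mul_inv_cancel_left]⟩
  have hPA : Commute P A := (hΘu.pow i).mul_left_cancel <| by
    rw [← mul_assoc, hP, hSA, ← mul_assoc, hΘA, mul_assoc, hP]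
  have hPD : ∀ X ∈ D, P * X ∈ D := by
    have : P ∈ {M : Matrix (Fin m) (Fin m) F | ∀ X ∈ D, M * X ∈ D} := by
      rw [hstabD]
      exact exists_aeval_eq_of_commute_of_irreducible_charpoly hirr hPA
    exact this
  have hPdet : IsUnit P.det := by
    rw [← hP, det_mul] at hSdet
    exact isUnit_of_mul_isUnit_right hSdet
  have hPD' : ∀ X ∈ D, P⁻¹ * X ∈ D := by
    have : P⁻¹ ∈ {M : Matrix (Fin m) (Fin m) F | ∀ X ∈ D, M * X ∈ D} := by
      rw [hstabD]
      refine exists_aeval_eq_of_commute_of_irreducible_charpoly hirr ?_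
      rw [← Matrix.zpow_neg_one]
      exact Matrix.Commute.zpow_left hPA _
    exact this
  refine ⟨i, hi, T⁻¹, (isUnit_nonsing_inv_iff).2 hT, ?_⟩
  ext Y
  constructor
  · rintro ⟨Z, hZ, rfl⟩
    obtain ⟨X, hX, rfl⟩ := (hmemC Z).1 hZ
    refine ⟨P * X, hPD X hX, ?_⟩
    simp only
    rw [mul_nonsing_inv_cancel_right _ _ hTdet, ← hP, Matrix.mul_assoc]
  · rintro ⟨X, hX, rfl⟩
    refine ⟨S * (P⁻¹ * X) * T, (hmemC _).2 ⟨_, hPD' X hX, rfl⟩, ?_⟩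
    simp only
    rw [mul_nonsing_inv_cancel_right _ _ hTdet, ← hP, Matrix.mul_assoc,
      mul_nonsing_inv_cancel_left _ _ hPdet]
end

section
/- Let A ∈ M_{m×m}(𝔽_q) have irreducible characteristic polynomial over 𝔽_q, and let S be an 𝔽_q-subalgebra of M_{m×m}(𝔽_q) with 𝔽_q[A] ⊊ S ⊆ M_{m×m}(𝔽_q) (strict containment). Then there exists a positive integer ℓ dividing m such that S is isomorphic as an 𝔽_q-algebra to the matrix algebra M_{m/ℓ}(𝔽_{q^ℓ}) of (m/ℓ)×(m/ℓ) matrices over the field 𝔽_{q^ℓ}. Moreover, any matrix C ∈ M_{m×m}(𝔽_q) that commutes with every element of the center of S belongs to S. -/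
open Polynomial in
/-- An endomorphism with irreducible characteristic polynomial has every nonzero vector as a cyclic
vector. -/
theorem LinearMap.exists_aeval_apply_eq_of_irreducible_charpoly {F V : Type*} [Field F]
    [AddCommGroup V] [Module F V] [FiniteDimensional F V] {f : Module.End F V}
    (hf : Irreducible f.charpoly) {v : V} (hv : v ≠ 0) (w : V) :
    ∃ p : F[X], aeval f p v = w := by
  let ev : degreeLT F (Module.finrank F V) →ₗ[F] V :=
    (LinearMap.applyₗ v).comp ((aeval f).toLinearMap.comp (Submodule.subtype _))
  have hinj : Function.Injective ev := by
    refine (injective_iff_map_eq_zero ev).2 fun ⟨p, hp⟩ hpv ↦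
      Subtype.ext (by_contra fun hp0 ↦ hv ?_)
    have hdvd : ¬ f.charpoly ∣ p := fun h ↦ hp0 <| eq_zero_of_dvd_of_degree_lt h <| by
      rw [degree_eq_natDegree hf.ne_zero, LinearMap.charpoly_natDegree]
      exact mem_degreeLT.1 hp
    obtain ⟨a, b, hab⟩ := hf.coprime_iff_not_dvd.2 hdvd
    have h := congr(aeval f $hab v)
    have hpv : aeval f p v = 0 := hpv
    simpa [LinearMap.aeval_self_charpoly, hpv] using h.symm
  have hrank : Module.finrank F (degreeLT F (Module.finrank F V)) = Module.finrank F V := by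
    rw [(degreeLTEquiv F _).finrank_eq, Module.finrank_fin_fun]
  have : Module.Finite F (degreeLT F (Module.finrank F V)) :=
    .equiv (degreeLTEquiv F _).symm
  obtain ⟨p, hp⟩ := (LinearMap.injective_iff_surjective_of_finrank_eq_finrank hrank).1 hinj w
  exact ⟨p, hp⟩

theorem Subalgebra.polynomial_aeval_mem {R A : Type*} [CommSemiring R] [Semiring A] [Algebra R A]
    (S : Subalgebra R A) {x : A} (hx : x ∈ S) (p : Polynomial R) : Polynomial.aeval x p ∈ S :=
  Algebra.adjoin_le (Set.singleton_subset_iff.2 hx)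
    (Polynomial.aeval_mem_adjoin_singleton R x)

open Polynomial in
theorem LinearMap.exists_eq_aeval_of_commute_of_irreducible_charpoly {F V : Type*} [Field F]
    [AddCommGroup V] [Module F V] [FiniteDimensional F V] {f g : Module.End F V}
    (hf : Irreducible f.charpoly) (hfg : Commute f g) : ∃ p : F[X], g = aeval f p := by
  cases subsingleton_or_nontrivial V with
  | inl _ => exact ⟨0, Subsingleton.elim _ _⟩
  | inr _ =>
    obtain ⟨v, hv⟩ := exists_ne (0 : V)
    obtain ⟨p, hp⟩ := exists_aeval_apply_eq_of_irreducible_charpoly hf hv (g v)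
    refine ⟨p, LinearMap.ext fun w ↦ ?_⟩
    obtain ⟨r, rfl⟩ := exists_aeval_apply_eq_of_irreducible_charpoly hf hv w
    have hr : Commute (aeval f r) g :=
      (Subalgebra.mem_centralizer_iff F).1 ((Subalgebra.centralizer F {g}).polynomial_aeval_mem
        ((Subalgebra.mem_centralizer_iff F).2 fun _ h ↦ h ▸ hfg.symm.eq) r) g rfl |>.symm
    rw [← Module.End.mul_apply, ← hr.eq, Module.End.mul_apply, ← hp, ← Module.End.mul_apply,
      ← Module.End.mul_apply, ← map_mul, ← map_mul, mul_comm]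

theorem Subalgebra.isSimpleModule_of_irreducible_charpoly {F V : Type*} [Field F]
    [AddCommGroup V] [Module F V] [FiniteDimensional F V] [Nontrivial V] {f : Module.End F V}
    (hf : Irreducible f.charpoly) {S : Subalgebra F (Module.End F V)} (hfS : f ∈ S) :
    IsSimpleModule S V :=
  isSimpleModule_iff_toSpanSingleton_surjective.2 ⟨‹_›, fun v hv w ↦ by
    obtain ⟨p, hp⟩ := LinearMap.exists_aeval_apply_eq_of_irreducible_charpoly hf hv w
    exact ⟨⟨Polynomial.aeval f p, S.polynomial_aeval_mem hfS p⟩, hp⟩⟩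

/-- A subalgebra of `Module.End F V` that consists exactly of the `K`-linear maps, for a field `K`
acting on `V`, is a matrix algebra over `K`. -/
theorem Subalgebra.nonempty_algEquiv_matrix_of_mem_iff {F K V : Type*} [Field F] [Field K]
    [Algebra F K] [AddCommGroup V] [Module F V] [Module K V] [IsScalarTower F K V]
    [FiniteDimensional K V] (S : Subalgebra F (Module.End F V))
    (hS : ∀ g : Module.End F V, g ∈ S ↔ ∀ (k : K) (v : V), g (k • v) = k • g v)
    {n : ℕ} (hn : Module.finrank K V = n) :
    Nonempty (S ≃ₐ[F] Matrix (Fin n) (Fin n) K) := by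
  let φ : S →ₐ[F] Module.End K V :=
    { toFun g := { g.1 with map_smul' := (hS g.1).1 g.2 }
      map_one' := rfl
      map_mul' _ _ := rfl
      map_zero' := rfl
      map_add' _ _ := rfl
      commutes' r := by ext v; simp }
  have hφ : Function.Bijective φ := by
    refine ⟨fun g h hgh ↦ Subtype.ext (LinearMap.ext fun v ↦ congr($hgh v)), fun g ↦ ?_⟩
    exact ⟨⟨g.restrictScalars F, (hS _).2 fun k v ↦ map_smul g k v⟩, rfl⟩
  exact ⟨(AlgEquiv.ofBijective φ hφ).trans
    ((LinearMap.toMatrixAlgEquiv (Module.finBasisOfFinrankEq K V hn)).restrictScalars F)⟩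

/-- A subalgebra containing an endomorphism with irreducible characteristic polynomial contains
every map that commutes with its center. -/
theorem Subalgebra.mem_of_commute_center_of_irreducible_charpoly {F V : Type*} [Field F]
    [AddCommGroup V] [Module F V] [FiniteDimensional F V] [Nontrivial V] {f : Module.End F V}
    (hf : Irreducible f.charpoly) {S : Subalgebra F (Module.End F V)} (hfS : f ∈ S)
    {c : Module.End F V} (hc : ∀ z ∈ S, (∀ w ∈ S, z * w = w * z) → c * z = z * c) : c ∈ S := by
  have := isSimpleModule_of_irreducible_charpoly hf hfS
  let c' : Module.End (Module.End S V) V :=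
    { c with
      map_smul' d v := by
        let z : Module.End F V := d.restrictScalars F
        have hz : ∀ w ∈ S, z * w = w * z := fun w hw ↦
          LinearMap.ext fun v ↦ d.map_smul (⟨w, hw⟩ : S) v
        obtain ⟨p, hp⟩ := LinearMap.exists_eq_aeval_of_commute_of_irreducible_charpoly hf
          (g := z) (hz f hfS).symm
        exact congr($(hc z (hp ▸ S.polynomial_aeval_mem hfS p) hz) v) }
  have : Module.Finite (Module.End S V) V := Module.Finite.of_restrictScalars_finite F _ V
  obtain ⟨g, hg⟩ := Module.Finite.toModuleEnd_moduleEnd_surjective (R := S) (M := V) c'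
  have : c = g.1 := LinearMap.ext fun v ↦ congr($hg.symm v)
  exact this ▸ g.2

theorem Subalgebra.exists_algEquiv_matrix_of_irreducible_charpoly {F V : Type*} [Field F]
    [Fintype F] [AddCommGroup V] [Module F V] [FiniteDimensional F V] [Nontrivial V]
    {f : Module.End F V} (hf : Irreducible f.charpoly) {S : Subalgebra F (Module.End F V)}
    (hfS : f ∈ S) : ∃ ℓ : ℕ, 0 < ℓ ∧ ℓ ∣ Module.finrank F V ∧
      ∃ (K : Type) (_ : Field K) (_ : Fintype K) (_ : Algebra F K),
        Fintype.card K = Fintype.card F ^ ℓ ∧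
        Nonempty (S ≃ₐ[F] Matrix (Fin (Module.finrank F V / ℓ))
          (Fin (Module.finrank F V / ℓ)) K) := by
  classical
  have := isSimpleModule_of_irreducible_charpoly hf hfS
  have : Finite V := Module.finite_of_finite F
  let D := Module.End S V
  have : Finite D := DFunLike.finite D
  let _ : Field D := littleWedderburn D
  let _ : Algebra F D := Module.End.instAlgebra F S V
  have : IsScalarTower F D V := ⟨fun _ _ _ ↦ rfl⟩
  have hS (g : Module.End F V) : g ∈ S ↔ ∀ (k : D) (v : V), g (k • v) = k • g v := by
    refine ⟨fun hg k v ↦ (k.map_smul (⟨g, hg⟩ : S) v).symm, fun hg ↦ ?_⟩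
    refine mem_of_commute_center_of_irreducible_charpoly hf hfS fun z _ hz ↦ ?_
    let k : D := { z with map_smul' := fun w v ↦ congr($(hz w.1 w.2) v) }
    exact LinearMap.ext fun v ↦ hg k v
  have : Module.Finite F D := Module.Finite.of_finite
  have : Module.Finite D V := Module.Finite.of_finite
  have hmul := Module.finrank_mul_finrank F D V
  have hpos : 0 < Module.finrank F D := Module.finrank_pos
  have hdiv : Module.finrank D V = Module.finrank F V / Module.finrank F D := by
    rw [← hmul, Nat.mul_div_cancel_left _ hpos]
  obtain ⟨e⟩ := S.nonempty_algEquiv_matrix_of_mem_iff hS hdiv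
  have : Finite (Shrink.{0} D) := .of_equiv D (equivShrink.{0} D)
  let _ : Fintype (Shrink.{0} D) := .ofFinite _
  refine ⟨Module.finrank F D, hpos, ⟨_, hmul.symm⟩, Shrink.{0} D, inferInstance,
    inferInstance, inferInstance, ?_, ⟨e.trans (Shrink.algEquiv.{0} F D).symm.mapMatrix⟩⟩
  rw [← Nat.card_eq_fintype_card, ← Nat.card_congr (equivShrink.{0} D),
    Module.natCard_eq_pow_finrank (K := F), Nat.card_eq_fintype_card]

/-- If 𝔽_q[A] ⊊ S ⊆ M_{m×m}(𝔽_q), where A has irreducible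
characteristic polynomial and S is an 𝔽_q-subalgebra, then S is isomorphic as an
𝔽_q-algebra to M_{m/ℓ}(𝔽_{q^ℓ}) for some ℓ ∣ m, and every matrix commuting with
the center of S belongs to S. -/
theorem algebra_containing_Fqm_is_matrix_algebra
    {F : Type*} [Field F] [Fintype F] {m : ℕ}
    (A : Matrix (Fin m) (Fin m) F) (hirr : Irreducible A.charpoly)
    (S : Subalgebra F (Matrix (Fin m) (Fin m) F))
    (hsub : {M : Matrix (Fin m) (Fin m) F | ∃ p : Polynomial F, M = Polynomial.aeval A p}
      ⊂ (S : Set (Matrix (Fin m) (Fin m) F))) :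
    (∃ ℓ : ℕ, 0 < ℓ ∧ ℓ ∣ m ∧
      ∃ (K : Type) (_ : Field K) (_ : Fintype K) (_ : Algebra F K),
        Fintype.card K = Fintype.card F ^ ℓ ∧
        Nonempty (S ≃ₐ[F] Matrix (Fin (m / ℓ)) (Fin (m / ℓ)) K)) ∧
    (∀ C : Matrix (Fin m) (Fin m) F,
      (∀ Z ∈ S, (∀ W ∈ S, Z * W = W * Z) → C * Z = Z * C) → C ∈ S) := by
  have hm : 0 < m := by
    rw [← Fintype.card_fin m, ← A.charpoly_natDegree_eq_dim]
    exact hirr.natDegree_pos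
  have : Nonempty (Fin m) := ⟨⟨0, hm⟩⟩
  let φ := Matrix.toLinAlgEquiv' (R := F) (n := Fin m)
  let e : S ≃ₐ[F] S.map φ.toAlgHom := S.equivMapOfInjective φ.toAlgHom φ.injective
  have hf : Irreducible (φ A).charpoly := by
    rwa [show (φ A).charpoly = A.charpoly from Matrix.charpoly_toLin' A]
  have hA : A ∈ S := hsub.subset ⟨Polynomial.X, by simp⟩
  have hfS : φ A ∈ S.map φ.toAlgHom := ⟨A, hA, rfl⟩
  constructor
  · obtain ⟨ℓ, hℓ, hdvd, K, _, _, _, hcard, ⟨e'⟩⟩ :=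
      Subalgebra.exists_algEquiv_matrix_of_irreducible_charpoly hf hfS
    rw [Module.finrank_fin_fun] at hdvd e'
    exact ⟨ℓ, hℓ, hdvd, K, _, _, _, hcard, ⟨e.trans e'⟩⟩
  · intro C hC
    have hφC : φ C ∈ S.map φ.toAlgHom := by
      refine Subalgebra.mem_of_commute_center_of_irreducible_charpoly hf hfS ?_
      rintro _ ⟨Z, hZ, rfl⟩ hcomm
      have h := hC Z hZ fun W hW ↦ φ.injective <|
        (map_mul φ Z W).trans ((hcomm (φ W) ⟨W, hW, rfl⟩).trans (map_mul φ W Z).symm)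
      exact (map_mul φ C Z).symm.trans (congr(φ $h).trans (map_mul φ Z C))
    obtain ⟨B, hB, hBC⟩ := hφC
    exact φ.injective hBC ▸ hB
end

section
/- Let 𝒞, 𝒟 ⊆ M_{m×n}(𝔽_q) be matrix codes that are left equivalent, i.e., P·𝒞 = 𝒟 for some P ∈ GL_m(𝔽_q). Suppose their left stabilizer algebras are equal, Stab_l(𝒞) = Stab_l(𝒟) =: S, that S is isomorphic as an 𝔽_q-algebra to the matrix algebra M_{m/ℓ}(𝔽_{q^ℓ}) for some positive integer ℓ dividing m, and that conjugation by P fixes the center of S pointwise (P·Z = Z·P for every Z in the center of S). Then 𝒞 = 𝒟. -/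
/-- A linear embedding of a space `A` of dimension `[K : F] * (dim_K V) ^ 2` into the `F`-linear
endomorphisms of `V` whose image consists of `K`-linear maps reaches every `K`-linear map. -/
theorem exists_eq_of_commute_smul_of_finrank_eq {F K V A : Type*} [Field F] [Field K] [Algebra F K]
    [FiniteDimensional F K] [AddCommGroup V] [Module F V] [Module K V] [IsScalarTower F K V]
    [FiniteDimensional F V] [AddCommGroup A] [Module F A]
    (φ : A →ₗ[F] Module.End F V) (hφ : Function.Injective φ)
    (hK : ∀ a (k : K) v, φ a (k • v) = k • φ a v)
    (hrank : Module.finrank F A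
      = Module.finrank F K * (Module.finrank K V * Module.finrank K V))
    (p : Module.End F V) (hp : ∀ (k : K) v, p (k • v) = k • p v) :
    ∃ a, φ a = p := by
  have : FiniteDimensional K V := Module.Finite.of_restrictScalars_finite F K V
  have : Module.Finite F (Module.End K V) := Module.Finite.trans K _
  let ψ : A →ₗ[F] Module.End K V :=
    { toFun := fun a => { toFun := φ a, map_add' := map_add _, map_smul' := hK a }
      map_add' := fun a b => by ext v; simp
      map_smul' := fun c a => by ext v; simp }
  have hψ : Function.Injective ψ := fun a b h =>
    hφ (LinearMap.ext fun v => LinearMap.congr_fun h v)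
  have : Module.Finite F A := Module.Finite.of_injective ψ hψ
  have hdim : Module.finrank F A = Module.finrank F (Module.End K V) := by
    rw [hrank, ← Module.finrank_mul_finrank F K (Module.End K V), Module.finrank_linearMap]
  obtain ⟨a, ha⟩ := (LinearMap.injective_iff_surjective_of_finrank_eq_finrank hdim).1 hψ
    { toFun := p, map_add' := map_add _, map_smul' := hp }
  exact ⟨a, LinearMap.ext fun v => LinearMap.congr_fun ha v⟩

/-- A subalgebra of `m × m` matrices over `F` isomorphic to `M_{m/ℓ}(K)`, with `[K : F] = ℓ`,
contains every matrix commuting with its center. -/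
theorem mem_of_commute_center_of_algEquiv_matrix {F K : Type*} [Field F] [Field K] [Algebra F K]
    [FiniteDimensional F K] {m ℓ : ℕ} (hℓ : 0 < ℓ) (hrank : Module.finrank F K = ℓ)
    (S : Subalgebra F (Matrix (Fin m) (Fin m) F))
    (e : S ≃ₐ[F] Matrix (Fin (m / ℓ)) (Fin (m / ℓ)) K) (P : Matrix (Fin m) (Fin m) F)
    (hP : ∀ Z ∈ S, (∀ W ∈ S, Z * W = W * Z) → P * Z = Z * P) : P ∈ S := by
  let f : K →ₐ[F] S := e.symm.toAlgHom.comp (IsScalarTower.toAlgHom F K _)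
  have hf : ∀ (k : K) (W : S), f k * W = W * f k := fun k W => e.injective <| by
    simpa [f] using Algebra.commutes k (e W)
  let g : K →ₐ[F] Module.End F (Fin m → F) :=
    (Matrix.toLinAlgEquiv' (R := F) (n := Fin m)).toAlgHom.comp (S.val.comp f)
  let : Module K (Fin m → F) := Module.compHom _ g.toRingHom
  have smul_eq : ∀ (k : K) (v : Fin m → F), k • v = (f k : Matrix (Fin m) (Fin m) F).mulVec v :=
    fun k v => rfl
  have : IsScalarTower F K (Fin m → F) := ⟨fun c k v => by
    simp [smul_eq, Matrix.smul_mulVec]⟩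
  let φ : S →ₗ[F] Module.End F (Fin m → F) :=
    (Matrix.toLinAlgEquiv' (R := F) (n := Fin m)).toLinearMap ∘ₗ S.val.toLinearMap
  have hcomm : ∀ (M : Matrix (Fin m) (Fin m) F),
      (∀ k : K, M * (f k : Matrix (Fin m) (Fin m) F) = f k * M) →
      ∀ (k : K) (v : Fin m → F), Matrix.toLinAlgEquiv' M (k • v)
        = k • Matrix.toLinAlgEquiv' M v := fun M hM k v => by
    simp [smul_eq, Matrix.toLinAlgEquiv'_apply, Matrix.mulVec_mulVec, hM]
  have hV : Module.finrank K (Fin m → F) = m / ℓ := by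
    have := Module.finrank_mul_finrank F K (Fin m → F)
    rw [hrank, Module.finrank_fin_fun] at this
    exact (Nat.div_eq_of_eq_mul_right hℓ this.symm).symm
  obtain ⟨a, ha⟩ := exists_eq_of_commute_smul_of_finrank_eq (K := K) φ
    ((Matrix.toLinAlgEquiv' (R := F) (n := Fin m)).injective.comp Subtype.val_injective)
    (fun a => hcomm a fun k => congrArg Subtype.val (hf k a).symm)
    (by
      rw [e.toLinearEquiv.finrank_eq, Module.finrank_matrix, hV]
      simp [mul_comm])
    (Matrix.toLinAlgEquiv' P)
    (hcomm P fun k => hP _ (f k).2 fun W hW => congrArg Subtype.val (hf k ⟨W, hW⟩))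
  have : (a : Matrix (Fin m) (Fin m) F) = P :=
    (Matrix.toLinAlgEquiv' (R := F) (n := Fin m)).injective ha
  exact this ▸ a.2


/-- Let P·𝒞 = 𝒟 with P ∈ GL_m(𝔽_q), suppose
Stab_l(𝒞) = Stab_l(𝒟) = S where S ≅ M_{m/ℓ}(𝔽_{q^ℓ}) as 𝔽_q-algebras for some
ℓ ∣ m, and suppose conjugation by P fixes the center of S pointwise.
Then 𝒞 = 𝒟. -/
theorem same_simple_left_stabilizer_left_equivalent_eq
    {F : Type*} [Field F] [Fintype F] {m n : ℕ}
    (C D : Submodule F (Matrix (Fin m) (Fin n) F))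
    (P : Matrix (Fin m) (Fin m) F) (hP : IsUnit P)
    (hCD : (fun X => P * X) '' (C : Set (Matrix (Fin m) (Fin n) F))
      = (D : Set (Matrix (Fin m) (Fin n) F)))
    (S : Subalgebra F (Matrix (Fin m) (Fin m) F))
    (hSC : (S : Set (Matrix (Fin m) (Fin m) F))
      = {M : Matrix (Fin m) (Fin m) F | ∀ X ∈ C, M * X ∈ C})
    (hSD : (S : Set (Matrix (Fin m) (Fin m) F))
      = {M : Matrix (Fin m) (Fin m) F | ∀ X ∈ D, M * X ∈ D})
    (ℓ : ℕ) (hℓpos : 0 < ℓ) (hℓdvd : ℓ ∣ m)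
    (K : Type) [Field K] [Fintype K] [Algebra F K]
    (hcardK : Fintype.card K = Fintype.card F ^ ℓ)
    (hiso : Nonempty (S ≃ₐ[F] Matrix (Fin (m / ℓ)) (Fin (m / ℓ)) K))
    (hcenter : ∀ Z ∈ S, (∀ W ∈ S, Z * W = W * Z) → P * Z = Z * P) :
    C = D := by
  have hrank : Module.finrank F K = ℓ := by
    have h := Module.card_eq_pow_finrank (K := F) (V := K)
    rw [hcardK] at h
    exact (Nat.pow_right_injective Fintype.one_lt_card h).symm
  obtain ⟨e⟩ := hiso
  have hPS : P ∈ (S : Set (Matrix (Fin m) (Fin m) F)) :=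
    mem_of_commute_center_of_algEquiv_matrix hℓpos hrank S e P hcenter
  have hPC : ∀ X ∈ C, P * X ∈ C := by rwa [hSC] at hPS
  have hinj : Function.Injective fun X : Matrix (Fin m) (Fin n) F => P * X := by
    obtain ⟨Q, hQ⟩ := hP.exists_left_inv
    intro X Y hXY
    simpa [← Matrix.mul_assoc, hQ] using congrArg (Q * ·) hXY
  have hsub : (D : Set (Matrix (Fin m) (Fin n) F)) ⊆ C := by
    rw [← hCD]
    rintro _ ⟨X, hX, rfl⟩
    exact hPC X hX
  refine SetLike.coe_injective (Set.eq_of_subset_of_ncard_le hsub ?_ (Set.toFinite _)).symm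
  rw [← hCD, Set.ncard_image_of_injective _ hinj]
end

section
/- Let Φ: 𝔽_q^n → M_{n×n}(𝔽_q) be the linear map sending (x₁,…,x_n) to the diagonal matrix with diagonal entries x₁,…,x_n. Then two linear codes 𝒞, 𝒟 ⊆ 𝔽_q^n are monomially equivalent if and only if the matrix codes Φ(𝒞) and Φ(𝒟) are equivalent, i.e., there exist P ∈ GL_n(𝔽_q) and Q ∈ GL_n(𝔽_q) with P·Φ(𝒞)·Q = Φ(𝒟). In other words, Φ sends positive (resp. negative) instances of the monomial equivalence problem to positive (resp. negative) instances of the matrix code equivalence problem. -/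
open Matrix

/-- A monomial matrix: the product of an invertible diagonal matrix and a
permutation matrix. -/
def IsMonomialMatrix {F : Type*} [Field F] {n : ℕ} (M : Matrix (Fin n) (Fin n) F) : Prop :=
  ∃ (d : Fin n → F) (σ : Equiv.Perm (Fin n)),
    (∀ i, d i ≠ 0) ∧ M = Matrix.diagonal d * σ.permMatrix F

open Finset in
/-- If two finite families in a partial order satisfying the ascending chain condition have, for
every `w`, equally many members above `w`, then one is a reindexing of the other. -/
theorem exists_perm_of_card_le_eq {ι α : Type*} [Fintype ι] [PartialOrder α] [WellFoundedGT α]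
    (a b : ι → α)
    (h : ∀ w, Nat.card {i // w ≤ a i} = Nat.card {i // w ≤ b i}) :
    ∃ σ : Equiv.Perm ι, ∀ i, b (σ i) = a i := by
  classical
  simp only [Nat.card_eq_fintype_card, Fintype.card_subtype] at h
  have hfiber : ∀ w, #{i | a i = w} = #{i | b i = w} := by
    intro w
    induction w using WellFoundedGT.induction with
    | ind w ih =>
    have hsplit : ∀ f : ι → α, #{i | w ≤ f i} = #{i | f i = w} + #{i | w < f i} := by
      intro f
      rw [← card_union_of_disjoint]
      · congr 1
        ext i
        simp [le_iff_eq_or_lt, eq_comm]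
      · exact disjoint_filter.2 fun i _ hi => by simp [hi]
    have hsum : ∀ f : ι → α, (∀ i, f i ∈ univ.image a ∪ univ.image b) →
        #{i | w < f i} = ∑ v ∈ univ.image a ∪ univ.image b with w < v, #{i | f i = v} := by
      intro f hf
      rw [card_eq_sum_card_fiberwise (f := f) (t := {v ∈ univ.image a ∪ univ.image b | w < v})]
      · refine sum_congr rfl fun v hv => ?_
        congr 1
        ext i
        have := (mem_filter.1 hv).2
        simp only [mem_filter, mem_univ, true_and]
        exact ⟨And.right, fun hi => ⟨hi ▸ this, hi⟩⟩
      · intro i hi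
        exact mem_filter.2 ⟨hf i, (mem_filter.1 hi).2⟩
    have hlt : #{i | w < a i} = #{i | w < b i} := by
      rw [hsum a (by simp), hsum b (by simp)]
      exact sum_congr rfl fun v hv => ih v (mem_filter.1 hv).2
    have := h w
    rw [hsplit, hsplit, hlt] at this
    exact Nat.add_right_cancel this
  have e : ∀ w, Nonempty ({i // a i = w} ≃ {i // b i = w}) := fun w =>
    Fintype.card_eq.1 (by simpa only [Fintype.card_subtype] using hfiber w)
  exact ⟨Equiv.ofFiberEquiv fun w => (e w).some, Equiv.ofFiberEquiv_map _⟩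

section Diagonal

variable {F ι E : Type*} [Field F] [Fintype ι] [DecidableEq ι]

/-- If `P * diagonal (u x) * Q` is the diagonal matrix `diagonal (v x)` for all `x ∈ s`, then at
most as many coordinates of `v` as of `u` are not identically zero on `s`. -/
theorem card_support_le_of_mul_diagonal_mul (P Q : Matrix ι ι F) (u v : E → ι → F) (s : Set E)
    (h : ∀ x ∈ s, P * diagonal (u x) * Q = diagonal (v x)) :
    Nat.card {i // ∃ x ∈ s, v x i ≠ 0} ≤ Nat.card {k // ∃ x ∈ s, u x k ≠ 0} := by
  classical
  choose x hxs hx using fun i : {i // ∃ x ∈ s, v x i ≠ 0} => i.2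
  let A : Matrix {i // ∃ x ∈ s, v x i ≠ 0} {k // ∃ x ∈ s, u x k ≠ 0} F := of fun i k => P i k
  let B : Matrix {k // ∃ x ∈ s, u x k ≠ 0} {i // ∃ x ∈ s, v x i ≠ 0} F :=
    of fun k i => u (x i) k * Q k i * (v (x i) i)⁻¹
  have hAB : A * B = 1 := by
    ext i j
    have hij := congrFun (congrFun (h (x j) (hxs j)) i) j
    rw [mul_apply] at hij
    simp only [mul_diagonal] at hij
    have hsub : ∑ k : {k // ∃ x ∈ s, u x k ≠ 0}, P i k * u (x j) k * Q k j
        = ∑ k, P i k * u (x j) k * Q k j := by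
      rw [← Fintype.sum_subtype_add_sum_subtype (fun k => ∃ x ∈ s, u x k ≠ 0), left_eq_add]
      refine Finset.sum_eq_zero fun k _ => ?_
      have hk : u (x j) k = 0 := not_not.1 fun hne => k.2 ⟨_, hxs j, hne⟩
      simp [hk]
    rw [mul_apply]
    calc ∑ k, A i k * B k j
        = (∑ k : {k // ∃ x ∈ s, u x k ≠ 0}, P i k * u (x j) k * Q k j) * (v (x j) j)⁻¹ := by
          simp only [A, B, of_apply, Finset.sum_mul, mul_assoc]
      _ = (1 : Matrix _ _ F) i j := by
          rw [hsub, hij, diagonal_apply, one_apply]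
          by_cases hne : i = j
          · subst hne
            simp [hx i]
          · simp [hne, Subtype.coe_injective.ne hne]
  rw [Nat.card_eq_fintype_card, Nat.card_eq_fintype_card]
  calc _ = (A * B).rank := by rw [hAB, rank_one]
    _ ≤ A.rank := rank_mul_le_left A B
    _ ≤ _ := rank_le_card_width A

end Diagonal

/-- Linear forms with the same kernel differ by a nonzero scalar. -/
theorem Module.Dual.exists_ne_zero_smul_eq_of_ker_eq {F V : Type*} [Field F] [AddCommGroup V]
    [Module F V] {f g : Module.Dual F V} (h : LinearMap.ker f = LinearMap.ker g) :
    ∃ c : F, c ≠ 0 ∧ g = c • f := by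
  obtain rfl | hf := eq_or_ne f 0
  · exact ⟨1, one_ne_zero, by rw [smul_zero, ← LinearMap.ker_eq_top, ← h, LinearMap.ker_zero]⟩
  obtain ⟨x, hx⟩ := DFunLike.ne_iff.1 hf
  rw [LinearMap.zero_apply] at hx
  have hgx : g x ≠ 0 := fun hg => hx (LinearMap.mem_ker.1 (h ▸ LinearMap.mem_ker.2 hg))
  refine ⟨g x / f x, div_ne_zero hgx hx, LinearMap.ext fun y => ?_⟩
  have hy : y - (f y / f x) • x ∈ LinearMap.ker f := by simp [hx]
  rw [h, LinearMap.mem_ker, map_sub, map_smul, sub_eq_zero] at hy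
  rw [hy, LinearMap.smul_apply, smul_eq_mul, smul_eq_mul]
  ring

/-- If multiplication by invertible matrices sends the diagonal matrices of a code to diagonal
matrices, then it acts on their diagonals as a monomial matrix. -/
theorem exists_isMonomialMatrix_of_mul_diagonal_mul {F : Type*} [Field F] {n : ℕ}
    (C : Submodule F (Fin n → F)) (P Q : Matrix (Fin n) (Fin n) F) (hP : IsUnit P) (hQ : IsUnit Q)
    (h : ∀ x ∈ C, (P * diagonal x * Q).IsDiag) :
    ∃ M, IsMonomialMatrix M ∧ ∀ x ∈ C, P * diagonal x * Q = diagonal (x ᵥ* M) := by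
  let u (k : Fin n) : Module.Dual F C := LinearMap.proj k ∘ₗ C.subtype
  let v (i : Fin n) : Module.Dual F C :=
    { toFun x := (P * diagonal (x : Fin n → F) * Q) i i
      map_add' x y := by
        have hxy : diagonal (↑(x + y) : Fin n → F) = diagonal x + diagonal y :=
          (diagonal_add _ _).symm
        rw [hxy, mul_add, add_mul, Matrix.add_apply]
      map_smul' c x := by simp [diagonal_smul] }
  have huv (x : C) : P * diagonal (u · x) * Q = diagonal (v · x) :=
    (h x x.2).diagonal_diag.symm
  have hvu (x : C) : P⁻¹ * diagonal (v · x) * Q⁻¹ = diagonal (u · x) := by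
    rw [isUnit_iff_isUnit_det] at hP hQ
    rw [← huv, mul_assoc P, nonsing_inv_mul_cancel_left _ _ hP, mul_nonsing_inv_cancel_right _ _ hQ]
  have hcard (W : Submodule F C) : Nat.card {k // W ≤ LinearMap.ker (u k)} =
      Nat.card {i // W ≤ LinearMap.ker (v i)} := by
    have hle := card_support_le_of_mul_diagonal_mul P Q (fun x k => u k x) (fun x i => v i x) W
      fun x _ => huv x
    have hge := card_support_le_of_mul_diagonal_mul P⁻¹ Q⁻¹ (fun x i => v i x) (fun x k => u k x) W
      fun x _ => hvu x
    have hcompl (w : Fin n → Module.Dual F C) :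
        Nat.card {i // W ≤ LinearMap.ker (w i)} + Nat.card {i // ∃ x ∈ (W : Set C), w i x ≠ 0}
          = n := by
      classical
      have hiff (i) : (∃ x ∈ (W : Set C), w i x ≠ 0) ↔ ¬ W ≤ LinearMap.ker (w i) := by
        simp [SetLike.not_le_iff_exists]
      simp only [hiff, Nat.card_eq_fintype_card]
      rw [Fintype.card_subtype_compl, Fintype.card_fin]
      have := Fintype.card_subtype_le fun i => W ≤ LinearMap.ker (w i)
      rw [Fintype.card_fin] at this
      omega
    have := hcompl u
    have := hcompl v
    omega
  obtain ⟨σ, hσ⟩ := exists_perm_of_card_le_eq _ _ hcard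
  choose d hd hvd using fun k => Module.Dual.exists_ne_zero_smul_eq_of_ker_eq (hσ k).symm
  refine ⟨_, ⟨d, σ, hd, rfl⟩, fun x hx => ?_⟩
  rw [show P * diagonal x * Q = diagonal (v · ⟨x, hx⟩) from huv ⟨x, hx⟩]
  congr 1
  ext j
  obtain ⟨k, rfl⟩ := σ.surjective j
  rw [hvd, ← vecMul_vecMul, vecMul_permMatrix]
  simp [u, vecMul_diagonal, mul_comm]

/-- A monomial matrix acts on diagonal matrices as multiplication by invertible matrices. -/
theorem IsMonomialMatrix.exists_mul_diagonal_mul {F : Type*} [Field F] {n : ℕ}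
    {M : Matrix (Fin n) (Fin n) F} (hM : IsMonomialMatrix M) :
    ∃ P Q : Matrix (Fin n) (Fin n) F, IsUnit P ∧ IsUnit Q ∧
      ∀ x, P * diagonal x * Q = diagonal (x ᵥ* M) := by
  obtain ⟨d, σ, hd, rfl⟩ := hM
  have hperm (τ : Equiv.Perm (Fin n)) : IsUnit (τ.permMatrix F) := by
    simpa using (Group.isUnit τ⁻¹).map (permMatrixHom (n := Fin n) (R := F))
  refine ⟨σ⁻¹.permMatrix F, diagonal d * σ.permMatrix F, hperm _, ?_, fun x => ?_⟩
  · exact (isUnit_diagonal.2 (Pi.isUnit_iff.2 fun i => (hd i).isUnit)).mul (hperm σ)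
  · rw [← mul_assoc, mul_assoc _ (diagonal x), diagonal_mul_diagonal, ← vecMul_vecMul,
      vecMul_permMatrix]
    ext i j
    simp [PEquiv.toMatrix_toPEquiv_mul, PEquiv.mul_toMatrix_toPEquiv, diagonal_apply,
      vecMul_diagonal]

/-- The isometry Φ : 𝔽_q^n → M_{n×n}(𝔽_q) sending a vector to the
corresponding diagonal matrix sends positive (resp. negative) instances of the
monomial equivalence problem to positive (resp. negative) instances of the
matrix code equivalence problem: 𝒞 and 𝒟 are monomially equivalent iff the
matrix codes Φ(𝒞) and Φ(𝒟) are equivalent. -/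
theorem monomial_equivalence_iff_matrix_code_equivalence
    {F : Type*} [Field F] [Fintype F] {n : ℕ}
    (C D : Submodule F (Fin n → F)) :
    (∃ M : Matrix (Fin n) (Fin n) F, IsMonomialMatrix M ∧
      (fun x => Matrix.vecMul x M) '' (C : Set (Fin n → F)) = (D : Set (Fin n → F))) ↔
    (∃ P Q : Matrix (Fin n) (Fin n) F, IsUnit P ∧ IsUnit Q ∧
      (fun X => P * X * Q) '' (Matrix.diagonal '' (C : Set (Fin n → F)))
        = Matrix.diagonal '' (D : Set (Fin n → F))) := by
  have himage {M P Q : Matrix (Fin n) (Fin n) F}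
      (h : ∀ x ∈ C, P * diagonal x * Q = diagonal (x ᵥ* M)) :
      (fun X => P * X * Q) '' (diagonal '' (C : Set (Fin n → F))) = diagonal '' D ↔
        (fun x => x ᵥ* M) '' (C : Set (Fin n → F)) = D := by
    rw [← diagonal_injective.image_injective.eq_iff, Set.image_image, Set.image_image,
      Set.image_congr h]
  constructor
  · rintro ⟨M, hM, hCD⟩
    obtain ⟨P, Q, hP, hQ, h⟩ := hM.exists_mul_diagonal_mul
    exact ⟨P, Q, hP, hQ, (himage fun x _ => h x).2 hCD⟩
  · rintro ⟨P, Q, hP, hQ, hCD⟩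
    have hdiag (x) (hx : x ∈ C) : (P * diagonal x * Q).IsDiag := by
      have hmem : P * diagonal x * Q ∈ diagonal '' (D : Set (Fin n → F)) :=
        hCD ▸ ⟨_, ⟨x, hx, rfl⟩, rfl⟩
      obtain ⟨y, -, hy⟩ := hmem
      exact hy ▸ isDiag_diagonal y
    obtain ⟨M, hM, h⟩ := exists_isMonomialMatrix_of_mul_diagonal_mul C P Q hP hQ hdiag
    exact ⟨M, hM, (himage h).1 hCD⟩
end
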